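/- arXiv:2211.12982 — 9 statements merged into one kernel-verified Lean document; each statement's English description precedes it below -/
import Mathlib

section
/- For every generalised arrival instance G with switching vertices V_S and switching-position set Q, there exists a generalised arrival instance Exp(G) with no switching vertices whose vertex set is (V × Q) together with a fresh target vertex t', whose start vertex is (s, q_0), and whose edges are exactly the valid state transitions of G (with every state (t,q) connected to t'), such that val(Exp(G)) = val(G). -/
open Finset
open scoped ENNReal

/-- A generalised arrival instance on a finite vertex type `V`. -/
structure ArrivalInstance (V : Type) [Fintype V] [DecidableEq V] where
  /-- out-neighbours -/
  succ : V → Finset V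
  succ_nonempty : ∀ v, (succ v).Nonempty
  start : V
  target : V
  VR : Finset V
  VS : Finset V
  V1 : Finset V
  V2 : Finset V
  target_loop : succ target = {target}
  target_not_R : target ∉ VR
  target_not_S : target ∉ VS
  target_not_1 : target ∉ V1
  target_not_2 : target ∉ V2
  disj_RS : Disjoint VR VS
  disj_R1 : Disjoint VR V1
  disj_R2 : Disjoint VR V2
  disj_S1 : Disjoint VS V1
  disj_S2 : Disjoint VS V2
  disj_12 : Disjoint V1 V2
  /-- every vertex that belongs to no class moves deterministically
      along its unique out-edge (e.g. the target or a dead end). -/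
  cover : ∀ v, v ∉ VR → v ∉ VS → v ∉ V1 → v ∉ V2 → (succ v).card = 1
  P : V → V → ℝ≥0∞
  P_le_one : ∀ v w, P v w ≤ 1
  P_support : ∀ v ∈ VR, ∀ w, P v w ≠ 0 ↔ w ∈ succ v
  P_sum : ∀ v ∈ VR, ∑ w ∈ succ v, P v w = 1
  ord : V → List V
  ord_mem : ∀ v ∈ VS, ∀ w, w ∈ ord v ↔ w ∈ succ v

namespace ArrivalInstance

variable {V : Type} [Fintype V] [DecidableEq V]

/-- switching positions -/
abbrev QType (G : ArrivalInstance V) : Type := ∀ v : V, Fin (max (G.ord v).length 1)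

/-- states of the game -/
abbrev State (G : ArrivalInstance V) : Type := V × G.QType

def q0 (G : ArrivalInstance V) : G.QType :=
  fun _ => ⟨0, Nat.lt_of_lt_of_le Nat.one_pos (Nat.le_max_right _ _)⟩

def switchNext (G : ArrivalInstance V) (v : V) (q : G.QType) : V :=
  (G.ord v).getD (q v) v

def switchUpd (G : ArrivalInstance V) (v : V) (q : G.QType) : G.QType :=
  Function.update q v
    ⟨((q v : ℕ) + 1) % max (G.ord v).length 1,
      Nat.mod_lt _ (Nat.lt_of_lt_of_le Nat.one_pos (Nat.le_max_right _ _))⟩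

/-- one step of value iteration (Bellman operator) for the reachability game -/
noncomputable def bellman (G : ArrivalInstance V) (f : G.State → ℝ≥0∞) :
    G.State → ℝ≥0∞ := fun s =>
  if s.1 = G.target then 1
  else if s.1 ∈ G.VS then f (G.switchNext s.1 s.2, G.switchUpd s.1 s.2)
  else if s.1 ∈ G.VR then ∑ w ∈ G.succ s.1, G.P s.1 w * f (w, s.2)
  else if s.1 ∈ G.V2 then (G.succ s.1).inf' (G.succ_nonempty s.1) (fun w => f (w, s.2))
  else (G.succ s.1).sup' (G.succ_nonempty s.1) (fun w => f (w, s.2))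

/-- the value of the instance: the limit of value iteration from below,
    i.e. the value of the reachability game. -/
noncomputable def val (G : ArrivalInstance V) : ℝ≥0∞ :=
  ⨆ n : ℕ, (G.bellman)^[n] (fun _ => 0) (G.start, G.q0)

/-- transition probabilities of the Markov chain on states, for instances
    without player vertices -/
noncomputable def stepP (G : ArrivalInstance V) : G.State → G.State → ℝ≥0∞ :=
  fun s s' =>
    if s.1 ∈ G.VS then
      (if s'.1 = G.switchNext s.1 s.2 ∧ s'.2 = G.switchUpd s.1 s.2 then 1 else 0)
    else if s.1 ∈ G.VR then (if s'.2 = s.2 then G.P s.1 s'.1 else 0)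
    else (if s'.1 ∈ G.succ s.1 ∧ s'.2 = s.2 then 1 else 0)

/-- distribution of the chain after `n` steps, started at `(start, q0)` -/
noncomputable def dist (G : ArrivalInstance V) : ℕ → G.State → ℝ≥0∞
  | 0 => fun s => if s = (G.start, G.q0) then 1 else 0
  | n + 1 => fun s => ∑ s' : G.State, G.dist n s' * G.stepP s' s

/-- probability that the chain ever reaches the target (the target is absorbing) -/
noncomputable def chainVal (G : ArrivalInstance V) : ℝ≥0∞ :=
  ⨆ n : ℕ, ∑ q : G.QType, G.dist n (G.target, q)

/-- an {R,S}-instance: no player vertices -/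
def IsRS (G : ArrivalInstance V) : Prop := G.V1 = ∅ ∧ G.V2 = ∅

/-- simple form, with dead-end vertex `d` -/
structure SimpleForm (G : ArrivalInstance V) (d : V) : Prop where
  d_ne_target : d ≠ G.target
  d_loop : G.succ d = {d}
  d_not_R : d ∉ G.VR
  d_not_S : d ∉ G.VS
  d_not_1 : d ∉ G.V1
  d_not_2 : d ∉ G.V2
  classes_cover : ∀ v : V, v ≠ G.target → v ≠ d → v ∈ G.VR ∪ G.VS ∪ G.V1 ∪ G.V2
  degree_two : ∀ v : V, v ≠ G.target → v ≠ d → (G.succ v).card = 2 ∧ v ∉ G.succ v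
  rand_uniform : ∀ v ∈ G.VR, ∀ w ∈ G.succ v, G.P v w = 1 / 2
  switch_ord : ∀ v ∈ G.VS, (G.ord v).Nodup ∧ (G.ord v).length = 2

end ArrivalInstance

namespace ArrivalInstance

variable {V : Type} [Fintype V] [DecidableEq V]

def xSucc (G : ArrivalInstance V) : Option G.State → Finset (Option G.State)
  | none => {none}
  | some (v, q) =>
    if v = G.target then {none}
    else if v ∈ G.VS then {some (G.switchNext v q, G.switchUpd v q)}
    else (G.succ v).image (fun w => some (w, q))

def xSet (G : ArrivalInstance V) (A : Finset V) : Finset (Option G.State) :=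
  (A ×ˢ (Finset.univ : Finset G.QType)).map Function.Embedding.some

lemma some_mem_xSet (G : ArrivalInstance V) (A : Finset V) (v : V) (q : G.QType) :
    some (v, q) ∈ G.xSet A ↔ v ∈ A := by
  simp [xSet]

lemma none_mem_xSet (G : ArrivalInstance V) (A : Finset V) :
    none ∉ G.xSet A := by
  simp [xSet]

lemma xSet_disj (G : ArrivalInstance V) {A B : Finset V} (h : Disjoint A B) :
    Disjoint (G.xSet A) (G.xSet B) := by
  rw [Finset.disjoint_left]
  rintro (_ | ⟨v, q⟩) h1 h2
  · exact G.none_mem_xSet _ h1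
  · rw [some_mem_xSet] at h1 h2
    exact Finset.disjoint_left.1 h h1 h2

noncomputable def xP (G : ArrivalInstance V) : Option G.State → Option G.State → ℝ≥0∞
  | some (v, q), some (w, q') => if q' = q then G.P v w else 0
  | _, _ => 0

lemma some_inj (G : ArrivalInstance V) (q : G.QType) :
    Function.Injective (fun w : V => (some (w, q) : Option G.State)) := by
  intro a b h
  simpa using h

lemma VR_ne (G : ArrivalInstance V) {v : V} (h : v ∈ G.VR) : v ≠ G.target := by
  rintro rfl; exact G.target_not_R h

lemma VR_nS (G : ArrivalInstance V) {v : V} (h : v ∈ G.VR) : v ∉ G.VS :=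
  Finset.disjoint_left.1 G.disj_RS h

noncomputable def expand (G : ArrivalInstance V) : ArrivalInstance (Option G.State) where
  succ := G.xSucc
  succ_nonempty := by
    rintro (_ | ⟨v, q⟩)
    · simp [xSucc]
    · simp only [xSucc]
      split_ifs
      · simp
      · simp
      · exact (G.succ_nonempty v).image _
  start := some (G.start, G.q0)
  target := none
  VR := G.xSet G.VR
  VS := ∅
  V1 := G.xSet G.V1
  V2 := G.xSet G.V2
  target_loop := rfl
  target_not_R := G.none_mem_xSet _
  target_not_S := by simp
  target_not_1 := G.none_mem_xSet _
  target_not_2 := G.none_mem_xSet _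
  disj_RS := by simp
  disj_R1 := G.xSet_disj G.disj_R1
  disj_R2 := G.xSet_disj G.disj_R2
  disj_S1 := by simp
  disj_S2 := by simp
  disj_12 := G.xSet_disj G.disj_12
  cover := by
    rintro (_ | ⟨v, q⟩) hR - h1 h2
    · simp [xSucc]
    · rw [some_mem_xSet] at hR h1 h2
      simp only [xSucc]
      split_ifs with ht hS
      · simp
      · simp
      · rw [Finset.card_image_of_injective _ (G.some_inj q)]
        exact G.cover v hR hS h1 h2
  P := G.xP
  P_le_one := by
    rintro (_ | ⟨v, q⟩) (_ | ⟨w, q'⟩) <;> simp only [xP]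
    · exact zero_le_one
    · exact zero_le_one
    · exact zero_le_one
    · split_ifs
      · exact G.P_le_one _ _
      · exact zero_le_one
  P_support := by
    rintro (_ | ⟨v, q⟩) hR w
    · exact absurd hR (G.none_mem_xSet _)
    · rw [some_mem_xSet] at hR
      rcases w with _ | ⟨w, q'⟩
      · simp [xP, xSucc, G.VR_ne hR, G.VR_nS hR]
      · have := G.P_support v hR w
        by_cases hq : q' = q
        · subst hq
          simp [xP, xSucc, G.VR_ne hR, G.VR_nS hR, ← this]
        · simp [xP, xSucc, G.VR_ne hR, G.VR_nS hR, hq, Ne.symm hq]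
  P_sum := by
    rintro (_ | ⟨v, q⟩) hR
    · exact absurd hR (G.none_mem_xSet _)
    · rw [some_mem_xSet] at hR
      simp only [xSucc, G.VR_ne hR, G.VR_nS hR, if_false]
      rw [Finset.sum_image (fun a _ b _ h => G.some_inj q h)]
      simpa [xP] using G.P_sum v hR
  ord := fun _ => []
  ord_mem := by simp

lemma expand_upd_none (G : ArrivalInstance V) (f : G.expand.State → ℝ≥0∞)
    (p : G.expand.QType) : G.expand.bellman f (none, p) = 1 := by
  unfold bellman
  exact if_pos rfl

lemma expand_bellman (G : ArrivalInstance V) (f : G.State → ℝ≥0∞)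
    (c : ℝ≥0∞) (f' : G.expand.State → ℝ≥0∞)
    (h0 : ∀ p, f' (none, p) = c) (h : ∀ x p, f' (some x, p) = f x)
    (v : V) (q : G.QType) (p : G.expand.QType) :
    G.expand.bellman f' (some (v, q), p) = if v = G.target then c else G.bellman f (v, q) := by
  have hT : (some (v, q) : Option G.State) ≠ G.expand.target := by
    change (some (v, q) : Option G.State) ≠ none
    simp
  have hS : (some (v, q) : Option G.State) ∉ G.expand.VS := Finset.notMem_empty _
  have hR : (some (v, q) : Option G.State) ∈ G.expand.VR ↔ v ∈ G.VR := G.some_mem_xSet _ v q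
  have h2 : (some (v, q) : Option G.State) ∈ G.expand.V2 ↔ v ∈ G.V2 := G.some_mem_xSet _ v q
  have hs : G.expand.succ (some (v, q)) = G.xSucc (some (v, q)) := rfl
  have hP : ∀ w, G.expand.P (some (v, q)) (some (w, q)) = G.P v w := fun w => by
    change G.xP (some (v, q)) (some (w, q)) = _
    simp [xP]
  unfold bellman
  simp only [if_neg hT, if_neg hS, hR, h2]
  by_cases ht : v = G.target
  · have hs' : G.expand.succ (some (v, q)) = {none} := by rw [hs]; simp [xSucc, ht]
    have a : v ∉ G.VR := ht ▸ G.target_not_R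
    have b : v ∉ G.V2 := ht ▸ G.target_not_2
    simp only [if_neg a, if_neg b, if_pos ht, hs', Finset.sup'_singleton, h0]
  · by_cases hvS : v ∈ G.VS
    · have hs' : G.expand.succ (some (v, q)) = {some (G.switchNext v q, G.switchUpd v q)} := by
        rw [hs]; simp [xSucc, ht, hvS]
      have a : v ∉ G.VR := Finset.disjoint_right.1 G.disj_RS hvS
      have b : v ∉ G.V2 := Finset.disjoint_left.1 G.disj_S2 hvS
      simp only [if_neg a, if_neg b, if_neg ht, if_pos hvS, hs', Finset.sup'_singleton, h]
    · have hs' : G.expand.succ (some (v, q)) = (G.succ v).image (fun w => some (w, q)) := by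
        rw [hs]; simp [xSucc, ht, hvS]
      simp only [if_neg ht, if_neg hvS, hs']
      split_ifs
      · rw [Finset.sum_image (fun a _ b _ h => G.some_inj q h)]
        simp only [hP, h]
      · rw [Finset.inf'_image]
        simp only [Function.comp_def, h]
      · rw [Finset.sup'_image]
        simp only [Function.comp_def, h]

lemma bellman_zero_step (G : ArrivalInstance V) (s : G.State) (hs : s.1 ≠ G.target) :
    G.bellman (fun _ => 0) s = 0 := by
  unfold bellman
  simp [hs]

lemma expand_iter (G : ArrivalInstance V) (n : ℕ) :
    ∀ (x : G.State) (p : G.expand.QType),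
      (G.expand.bellman)^[n + 1] (fun _ => 0) (some x, p) = (G.bellman)^[n] (fun _ => 0) x := by
  induction n with
  | zero =>
    rintro ⟨v, q⟩ p
    simp only [zero_add, Function.iterate_one, Function.iterate_zero, id]
    rw [G.expand_bellman (fun _ => 0) 0 _ (fun _ => rfl) (fun _ _ => rfl)]
    split_ifs with ht
    · rfl
    · exact G.bellman_zero_step _ ht
  | succ n ih =>
    rintro ⟨v, q⟩ p
    rw [Function.iterate_succ_apply', Function.iterate_succ_apply' G.bellman]
    rw [G.expand_bellman _ 1 _ (fun p => ?_) ih]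
    · split_ifs with ht
      · unfold bellman
        exact (if_pos ht).symm
      · rfl
    · rw [Function.iterate_succ_apply']
      exact G.expand_upd_none _ p

lemma expand_val (G : ArrivalInstance V) : G.expand.val = G.val := by
  unfold val
  rw [← sup_iSup_nat_succ]
  have : G.expand.start = some (G.start, G.q0) := rfl
  rw [this]
  simp only [expand_iter]
  simp

end ArrivalInstance

/-- expanding the switching positions into the vertices gives an
    exponentially larger instance `Exp(G)` without switching vertices, on the
    state space `V × Q` plus a fresh target, with the same value. -/
theorem stmt_1 {V : Type} [Fintype V] [DecidableEq V] (G : ArrivalInstance V) :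
    ∃ G' : ArrivalInstance (Option G.State),
      G'.target = none ∧
      G'.start = some (G.start, G.q0) ∧
      G'.VS = ∅ ∧
      (∀ q : G.QType, G'.succ (some (G.target, q)) = {none}) ∧
      (∀ (v : V) (q : G.QType), v ≠ G.target → v ∈ G.VS →
        G'.succ (some (v, q)) = {some (G.switchNext v q, G.switchUpd v q)}) ∧
      (∀ (v : V) (q : G.QType), v ≠ G.target → v ∉ G.VS →
        G'.succ (some (v, q)) = (G.succ v).image (fun w => some (w, q))) ∧
      (∀ (v : V) (q : G.QType),
        (some (v, q) ∈ G'.VR ↔ v ∈ G.VR) ∧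
        (some (v, q) ∈ G'.V1 ↔ v ∈ G.V1) ∧
        (some (v, q) ∈ G'.V2 ↔ v ∈ G.V2)) ∧
      (∀ v ∈ G.VR, ∀ (q : G.QType) (w : V),
        G'.P (some (v, q)) (some (w, q)) = G.P v w) ∧
      G'.val = G.val := by
  refine ⟨G.expand, rfl, rfl, rfl, fun q => ?_, fun v q ht hS => ?_, fun v q ht hS => ?_,
    fun v q => ⟨G.some_mem_xSet _ v q, G.some_mem_xSet _ v q, G.some_mem_xSet _ v q⟩,
    fun v _ q w => ?_, G.expand_val⟩
  · change G.xSucc (some (G.target, q)) = _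
    simp [ArrivalInstance.xSucc]
  · change G.xSucc (some (v, q)) = _
    simp [ArrivalInstance.xSucc, ht, hS]
  · change G.xSucc (some (v, q)) = _
    simp [ArrivalInstance.xSucc, ht, hS]
  · change G.xP (some (v, q)) (some (w, q)) = _
    simp [ArrivalInstance.xP]
end

section
/- If G is a generalised arrival instance in simple form with vertex set V and switching vertices V_S, then val(G) is a rational number which, written in lowest terms as p/q, satisfies 0 ≤ p, q ≤ 4^N, where N = |V| · 2^{|V_S|}. -/
open Finset
open scoped ENNReal

open Filter Topology

inductive ANode (S : Type) : Type
  | one : ANode S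
  | avg : S → S → ANode S
  | mx : S → S → ANode S
  | mn : S → S → ANode S

namespace ANode

noncomputable def ev {S : Type} (n : ANode S) (f : S → ℝ) : ℝ :=
  match n with
  | one => 1
  | avg a b => (f a + f b) / 2
  | mx a b => max (f a) (f b)
  | mn a b => min (f a) (f b)

theorem ev_mono {S : Type} (n : ANode S) {f g : S → ℝ} (h : ∀ s, f s ≤ g s) :
    n.ev f ≤ n.ev g := by
  cases n with
  | one => exact le_rfl
  | avg a b => simp only [ev]; linarith [h a, h b]
  | mx a b => exact max_le_max (h a) (h b)
  | mn a b => exact min_le_min (h a) (h b)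

theorem ev_cont {S : Type} (n : ANode S) : Continuous (fun f : S → ℝ => n.ev f) := by
  cases n <;> simp only [ev] <;> fun_prop

end ANode

theorem det_bound {S : Type} [Fintype S] [DecidableEq S] (A : Matrix S S ℤ)
    (h : ∀ i, ∑ j, |A i j| ≤ 4) : |A.det| ≤ 4 ^ Fintype.card S := by
  rw [← Matrix.det_transpose, Matrix.det_apply]
  calc |∑ σ : Equiv.Perm S, Equiv.Perm.sign σ • ∏ i, A.transpose (σ i) i|
      ≤ ∑ σ : Equiv.Perm S, |Equiv.Perm.sign σ • ∏ i, A.transpose (σ i) i| :=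
        Finset.abs_sum_le_sum_abs _ _
    _ = ∑ σ : Equiv.Perm S, ∏ i, |A i (σ i)| := by
        refine Finset.sum_congr rfl fun σ _ => ?_
        rw [← Finset.abs_prod]
        rcases Int.units_eq_one_or (Equiv.Perm.sign σ) with h | h <;> simp [h, Matrix.transpose_apply]
    _ ≤ ∑ f : S → S, ∏ i, |A i (f i)| := by
        have inj : Function.Injective (fun σ : Equiv.Perm S => (σ : S → S)) :=
          fun a b h => Equiv.ext (congrFun h)
        have hm := Finset.sum_map Finset.univ (⟨_, inj⟩ : Equiv.Perm S ↪ (S → S))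
          (fun f : S → S => ∏ i, |A i (f i)|)
        refine le_of_eq_of_le hm.symm ?_
        exact Finset.sum_le_sum_of_subset_of_nonneg (Finset.subset_univ _)
          (fun f _ _ => Finset.prod_nonneg fun i _ => abs_nonneg _)
    _ = ∏ i, ∑ j, |A i j| := by
        rw [Finset.prod_univ_sum]; simp
    _ ≤ ∏ _i : S, (4 : ℤ) :=
        Finset.prod_le_prod (fun i _ => Finset.sum_nonneg fun j _ => abs_nonneg _) (fun i _ => h i)
    _ = 4 ^ Fintype.card S := by simp

/-- integer rows of small norm that are integral at `x` -/
def rowSet {S : Type} [Fintype S] (x : S → ℝ) : Set (S → ℝ) :=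
  {r | ∃ r' : S → ℤ, (∀ i, r i = r' i) ∧ ∑ i, |r' i| ≤ 4 ∧ ∃ c : ℤ, ∑ i, r i * x i = c}

theorem of_span {S : Type} [Fintype S] [DecidableEq S] (x : S → ℝ)
    (hsp : Submodule.span ℝ (rowSet x) = ⊤) :
    ∃ D : ℤ, D ≠ 0 ∧ |D| ≤ 4 ^ Fintype.card S ∧ ∀ s, ∃ k : ℤ, (D : ℝ) * x s = k := by
  obtain ⟨b, hb, hspan, hli⟩ := exists_linearIndependent ℝ (rowSet x)
  rw [hsp] at hspan
  let B : Module.Basis b ℝ (S → ℝ) := Module.Basis.mk hli (by rw [Subtype.range_coe, hspan])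
  have : Fintype b := FiniteDimensional.fintypeBasisIndex B
  have hc : Fintype.card b = Fintype.card S := by
    rw [← Module.finrank_eq_card_basis B]; simp
  let e : S ≃ b := (Fintype.equivOfCardEq hc).symm
  have hr : ∀ s, ((e s : S → ℝ)) ∈ rowSet x := fun s => hb (e s).2
  choose A hA hA4 c hcx using hr
  let M : Matrix S S ℤ := A
  let MR : Matrix S S ℝ := M.map (Int.castRingHom ℝ)
  have hMR : ∀ s, MR s = (e s : S → ℝ) := fun s => by
    funext j; rw [hA]; rfl
  have hdet : MR.det ≠ 0 := by
    have hl : LinearIndependent ℝ MR.row := by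
      have h1 : LinearIndependent ℝ (fun s => (e s : S → ℝ)) := hli.comp e e.injective
      have : MR.row = (fun s => (e s : S → ℝ)) := funext hMR
      rw [this]; exact h1
    have := Matrix.linearIndependent_rows_iff_isUnit.1 hl
    exact ((Matrix.isUnit_iff_isUnit_det _).1 this).ne_zero
  have hd : MR.det = (M.det : ℝ) := by
    have := (Int.castRingHom ℝ).map_det M
    simpa [MR] using this.symm
  refine ⟨M.det, ?_, det_bound M hA4, fun s => ?_⟩
  · intro h; rw [hd, h] at hdet; simp at hdet
  · have h1 : MR.mulVec x = fun s => (c s : ℝ) := by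
      funext s
      rw [← hcx]
      simp only [Matrix.mulVec, dotProduct]
      rw [hMR]
    have h2 : MR.adjugate.mulVec (MR.mulVec x) = MR.det • x := by
      rw [Matrix.mulVec_mulVec, Matrix.adjugate_mul, Matrix.smul_mulVec, Matrix.one_mulVec]
    have h3 : MR.adjugate = M.adjugate.map (Int.castRingHom ℝ) :=
      ((Int.castRingHom ℝ).map_adjugate M).symm
    refine ⟨M.adjugate.mulVec c s, ?_⟩
    have h4 := congrFun h2 s
    rw [h1, h3, hd] at h4
    simp only [Pi.smul_apply, smul_eq_mul] at h4
    rw [← h4]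
    simp [Matrix.mulVec, dotProduct]

theorem span_top {S : Type} [Fintype S] [DecidableEq S] (N : S → ANode S) (x : S → ℝ)
    (hx0 : ∀ s, 0 ≤ x s) (hfix : ∀ s, (N s).ev x = x s)
    (hleast : ∀ z : S → ℝ, (∀ s, 0 ≤ z s) → (∀ s, (N s).ev z ≤ z s) → ∀ s, x s ≤ z s) :
    Submodule.span ℝ (rowSet x) = ⊤ := by
  by_contra hne
  obtain ⟨f, hf, hmap⟩ := Submodule.exists_dual_map_eq_bot_of_lt_top (lt_top_iff_ne_top.2 hne)
    inferInstance
  have hR : ∀ r ∈ rowSet x, f r = 0 := fun r hr => by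
    have : f r ∈ (Submodule.span ℝ (rowSet x)).map f :=
      Submodule.mem_map_of_mem (Submodule.subset_span hr)
    rw [hmap] at this; simpa using this
  let y : S → ℝ := fun s => f (Pi.single s 1)
  have key : ∀ (α β γ : ℤ) (s a b : S) (c : ℤ), |α| + |β| + |γ| ≤ 4 →
      α * x s + β * x a + γ * x b = c → α * y s + β * y a + γ * y b = 0 := by
    intro α β γ s a b c h4 h
    have := hR ((α : ℝ) • Pi.single s 1 + (β : ℝ) • Pi.single a 1 + (γ : ℝ) • Pi.single b 1) ?_
    · simpa [y] using this
    · refine ⟨(Pi.single s α + Pi.single a β + Pi.single b γ : S → ℤ), ?_, ?_, c, ?_⟩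
      · intro i
        simp only [Pi.add_apply, Pi.smul_apply, Pi.single_apply, smul_eq_mul]
        push_cast
        simp
      · refine le_trans ?_ h4
        calc _ ≤ ∑ i, (|Pi.single (M := fun _ => ℤ) s α i| + |Pi.single (M := fun _ => ℤ) a β i|
              + |Pi.single (M := fun _ => ℤ) b γ i|) :=
              Finset.sum_le_sum fun i _ => abs_add_three _ _ _
          _ = _ := by
              simp only [Finset.sum_add_distrib, Pi.single_apply, apply_ite abs, abs_zero]
              simp
      · rw [← h]
        simp [add_mul, Finset.sum_add_distrib, Pi.single_apply]
  have hEq : ∀ s a, x a = x s → y a = y s := fun s a h => by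
    have := key 1 (-1) 0 s a a 0 (by norm_num) (by push_cast; linarith)
    push_cast at this; linarith
  have hlt : ∀ s a, x a < x s → ∀ᶠ ε in 𝓝 (0 : ℝ), x a - ε * y a < x s - ε * y s := fun s a h => by
    have c1 : ContinuousAt (fun ε : ℝ => x a - ε * y a) 0 := by fun_prop
    have c2 : ContinuousAt (fun ε : ℝ => x s - ε * y s) 0 := by fun_prop
    exact c1.eventually_lt c2 (by simpa using h)
  have hle : ∀ s a, x a ≤ x s → ∀ᶠ ε in 𝓝 (0 : ℝ), x a - ε * y a ≤ x s - ε * y s := fun s a h => by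
    rcases h.eq_or_lt with h | h
    · rw [h, hEq s a h]; exact Eventually.of_forall fun _ => le_rfl
    · exact (hlt s a h).mono fun _ h => h.le
  have hev : ∀ᶠ ε in 𝓝 (0 : ℝ), ∀ s, x s ≤ x s - ε * y s := by
    have e1 : ∀ᶠ ε in 𝓝 (0 : ℝ), ∀ s, 0 ≤ x s - ε * y s := by
      rw [eventually_all]
      intro s
      rcases (hx0 s).eq_or_lt with h | h
      · have : y s = 0 := by
          have := key 1 0 0 s s s 0 (by norm_num) (by push_cast; linarith)
          simpa using this
        rw [this, ← h]; simp
      · have c2 : ContinuousAt (fun ε : ℝ => x s - ε * y s) 0 := by fun_prop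
        have := continuousAt_const.eventually_lt (f := fun _ : ℝ => (0 : ℝ)) c2 (by simpa using h)
        exact this.mono fun _ h => h.le
    have e2 : ∀ᶠ ε in 𝓝 (0 : ℝ), ∀ s, (N s).ev (fun s => x s - ε * y s) ≤ x s - ε * y s := by
      rw [eventually_all]
      intro s
      have hs := hfix s
      cases hN : N s with
      | one =>
        rw [hN] at hs
        simp only [ANode.ev] at hs ⊢
        have : y s = 0 := by
          have := key 1 0 0 s s s 1 (by norm_num) (by push_cast; linarith)
          simpa using this
        rw [this, ← hs]; simp
      | avg a b =>
        rw [hN] at hs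
        simp only [ANode.ev] at hs ⊢
        have := key 2 (-1) (-1) s a b 0 (by norm_num) (by push_cast; linarith)
        push_cast at this
        refine Eventually.of_forall fun ε => le_of_eq ?_
        rw [← hs]
        linear_combination (ε / 2) * this
      | mx a b =>
        rw [hN] at hs
        simp only [ANode.ev] at hs ⊢
        filter_upwards [hle s a (hs ▸ le_max_left _ _), hle s b (hs ▸ le_max_right _ _)] with ε h1 h2
        exact max_le h1 h2
      | mn a b =>
        rw [hN] at hs
        simp only [ANode.ev] at hs ⊢
        rcases min_choice (x a) (x b) with h | h
        · filter_upwards [hle s a (by rw [← hs, h])] with ε h1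
          exact (min_le_left _ _).trans h1
        · filter_upwards [hle s b (by rw [← hs, h])] with ε h1
          exact (min_le_right _ _).trans h1
    filter_upwards [e1, e2] with ε h1 h2
    exact hleast _ h1 h2
  obtain ⟨δ, hδ, hball⟩ := Metric.eventually_nhds_iff.1 hev
  have hy : ∀ s, y s = 0 := by
    intro s
    have h1 := hball (y := δ / 2) (by simp [abs_of_pos hδ]; linarith) s
    have h2 := hball (y := -(δ / 2)) (by simp [abs_of_pos hδ]; linarith) s
    have h3 : δ / 2 * y s = 0 := by linarith
    rcases mul_eq_zero.1 h3 with h | h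
    · linarith
    · exact h
  apply hf
  apply LinearMap.pi_ext'
  intro s
  ext
  simpa [y] using hy s

theorem abstract_main {S : Type} [Fintype S] [DecidableEq S] (N : S → ANode S)
    (h : ℕ → S → ℝ) (h0 : ∀ s, h 0 s = 0) (hs : ∀ n s, h (n + 1) s = (N s).ev (h n)) (s : S) :
    ∃ p q : ℕ, 0 < q ∧ Nat.Coprime p q ∧ p ≤ 4 ^ Fintype.card S ∧ q ≤ 4 ^ Fintype.card S ∧
      (⨆ n, ENNReal.ofReal (h n s)) = (p : ℝ≥0∞) / (q : ℝ≥0∞) := by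
  have hev0 : ∀ s, 0 ≤ (N s).ev (fun _ => 0) := fun s => by cases N s <;> simp [ANode.ev]
  have hmono1 : ∀ n s, h n s ≤ h (n + 1) s := by
    intro n
    induction n with
    | zero => intro s; rw [hs, h0, show h 0 = fun _ => 0 from funext h0]; exact hev0 s
    | succ n ih => intro s; rw [hs, hs]; exact ANode.ev_mono _ ih
  have hmono : ∀ s, Monotone (fun n => h n s) := fun s => monotone_nat_of_le_succ fun n => hmono1 n s
  have hpre : ∀ z : S → ℝ, (∀ s, 0 ≤ z s) → (∀ s, (N s).ev z ≤ z s) → ∀ n s, h n s ≤ z s := by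
    intro z z0 hz n
    induction n with
    | zero => intro s; rw [h0]; exact z0 s
    | succ n ih => intro s; rw [hs]; exact (ANode.ev_mono _ ih).trans (hz s)
  have h1 : ∀ n s, h n s ≤ 1 := hpre (fun _ => 1) (fun _ => zero_le_one) (fun s => by
    cases N s <;> simp [ANode.ev])
  let x : S → ℝ := fun s => ⨆ n, h n s
  have hbdd : ∀ s, BddAbove (Set.range fun n => h n s) := fun s =>
    ⟨1, by rintro _ ⟨n, rfl⟩; exact h1 n s⟩
  have hlim : ∀ s, Tendsto (fun n => h n s) atTop (𝓝 (x s)) := fun s =>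
    tendsto_atTop_ciSup (hmono s) (hbdd s)
  have hx0 : ∀ s, 0 ≤ x s := fun s => by
    have := le_ciSup (hbdd s) 0
    rw [← h0 s]; exact this
  have hx1 : ∀ s, x s ≤ 1 := fun s => ciSup_le fun n => h1 n s
  have hfix : ∀ s, (N s).ev x = x s := fun s => by
    have hl : Tendsto h atTop (𝓝 x) := tendsto_pi_nhds.2 hlim
    have t1 := ((N s).ev_cont.tendsto x).comp hl
    have t2 := (hlim s).comp (tendsto_add_atTop_nat 1)
    refine tendsto_nhds_unique t1 (t2.congr fun n => ?_)
    exact hs n s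
  have hsp := span_top N x hx0 hfix (fun z z0 hz s => ciSup_le fun n => hpre z z0 hz n s)
  obtain ⟨D, hD0, hD, hk⟩ := of_span x hsp
  obtain ⟨k, hk⟩ := hk s
  have hval : (⨆ n, ENNReal.ofReal (h n s)) = ENNReal.ofReal (x s) :=
    iSup_eq_of_tendsto (fun a b hab => ENNReal.ofReal_le_ofReal (hmono s hab))
      ((ENNReal.continuous_ofReal.tendsto _).comp (hlim s))
  have hDp : 0 < D.natAbs := Int.natAbs_pos.2 hD0
  have hDpR : (0 : ℝ) < D.natAbs := by exact_mod_cast hDp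
  have hkN : (D.natAbs : ℝ) * x s = k.natAbs := by
    have := congrArg abs hk
    rw [abs_mul, abs_of_nonneg (hx0 s)] at this
    simpa [Nat.cast_natAbs] using this
  have hkD : k.natAbs ≤ D.natAbs := by
    have : (k.natAbs : ℝ) ≤ D.natAbs := by
      rw [← hkN]; exact mul_le_of_le_one_right hDpR.le (hx1 s)
    exact_mod_cast this
  have hDn : D.natAbs ≤ 4 ^ Fintype.card S := by
    zify; exact hD
  have hg : 0 < Nat.gcd k.natAbs D.natAbs := Nat.gcd_pos_of_pos_right _ hDp
  refine ⟨k.natAbs / Nat.gcd k.natAbs D.natAbs, D.natAbs / Nat.gcd k.natAbs D.natAbs,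
    Nat.div_pos (Nat.le_of_dvd hDp (Nat.gcd_dvd_right _ _)) hg,
    Nat.coprime_div_gcd_div_gcd hg, (Nat.div_le_self _ _).trans (hkD.trans hDn),
    (Nat.div_le_self _ _).trans hDn, ?_⟩
  rw [hval]
  have hq : (0 : ℝ) < ((D.natAbs / Nat.gcd k.natAbs D.natAbs : ℕ) : ℝ) := by
    exact_mod_cast Nat.div_pos (Nat.le_of_dvd hDp (Nat.gcd_dvd_right _ _)) hg
  rw [← ENNReal.ofReal_natCast, ← ENNReal.ofReal_natCast, ← ENNReal.ofReal_div_of_pos hq]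
  congr 1
  have hgR : (Nat.gcd k.natAbs D.natAbs : ℝ) ≠ 0 := by exact_mod_cast hg.ne'
  rw [Nat.cast_div (Nat.gcd_dvd_left _ _) hgR, Nat.cast_div (Nat.gcd_dvd_right _ _) hgR,
    div_div_div_cancel_right₀ hgR, eq_div_iff hDpR.ne', mul_comm, hkN]

namespace ArrivalInstance

variable {V : Type} [Fintype V] [DecidableEq V]

/-- the states whose non-switching positions are zero -/
abbrev RState (G : ArrivalInstance V) : Type :=
  {s : G.State // ∀ v, v ∉ G.VS → (s.2 v : ℕ) = 0}

theorem card_RState (G : ArrivalInstance V) {d : V} (hG : G.SimpleForm d) :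
    Fintype.card G.RState ≤ Fintype.card V * 2 ^ G.VS.card := by
  have hlt : ∀ (q : G.QType) (u : {v // v ∈ G.VS}), (q u : ℕ) < 2 := fun q u => by
    have h1 := (q u).2
    have h2 := (hG.switch_ord u u.2).2
    omega
  have := Fintype.card_le_of_injective
    (fun s : G.RState => ((s.1.1, fun u => ⟨s.1.2 u, hlt s.1.2 u⟩) : V × ({v // v ∈ G.VS} → Fin 2)))
    (by
      rintro ⟨⟨v, q⟩, h⟩ ⟨⟨v', q'⟩, h'⟩ he
      simp only [Prod.mk.injEq] at he
      obtain ⟨rfl, he⟩ := he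
      congr 2
      funext u
      by_cases hu : u ∈ G.VS
      · have := congrFun he ⟨u, hu⟩
        simp only [Fin.mk.injEq] at this
        exact Fin.ext this
      · exact Fin.ext ((h u hu).trans (h' u hu).symm))
  simpa using this

theorem exists_node (G : ArrivalInstance V) {d : V} (hG : G.SimpleForm d) (s : G.RState) :
    ∃ n : ANode G.RState, ∀ (f : G.State → ℝ≥0∞) (g : G.RState → ℝ), (∀ t, 0 ≤ g t) →
      (∀ t : G.RState, f t.1 = ENNReal.ofReal (g t)) →
      G.bellman f s.1 = ENNReal.ofReal (n.ev g) := by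
  obtain ⟨⟨v, q⟩, hq⟩ := s
  have hmon : Monotone ENNReal.ofReal := fun a b h => ENNReal.ofReal_le_ofReal h
  by_cases ht : v = G.target
  · exact ⟨.one, fun f g _ _ => by simp [bellman, ht, ANode.ev]⟩
  by_cases hS : v ∈ G.VS
  · let t : G.RState := ⟨(G.switchNext v q, G.switchUpd v q), fun u hu => by
      have : u ≠ v := fun h => hu (h ▸ hS)
      simp only [switchUpd, Function.update_of_ne this]
      exact hq u hu⟩
    exact ⟨.mx t t, fun f g _ hfg => by simp [bellman, ht, hS, ANode.ev, ← hfg, t]⟩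
  let m : V → G.RState := fun w => ⟨(w, q), hq⟩
  by_cases hd : v = d
  · refine ⟨.mx (m d) (m d), fun f g _ hfg => ?_⟩
    subst hd
    simp [bellman, ht, hS, hG.d_not_R, hG.d_not_2, ANode.ev, ← hfg, m, hG.d_loop]
  obtain ⟨a, b, hab, hsucc⟩ := Finset.card_eq_two.1 (hG.degree_two v ht hd).1
  by_cases hR : v ∈ G.VR
  · refine ⟨.avg (m a) (m b), fun f g hg hfg => ?_⟩
    have ha := hG.rand_uniform v hR a (by simp [hsucc])
    have hb := hG.rand_uniform v hR b (by simp [hsucc])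
    have fa := hfg (m a)
    have fb := hfg (m b)
    simp only [m] at fa fb
    simp only [bellman, ht, hS, hR, ANode.ev, if_true, if_false, hsucc, Finset.sum_pair hab, ha, hb, fa, fb]
    rw [ENNReal.ofReal_div_of_pos two_pos, ENNReal.ofReal_add (hg _) (hg _), div_eq_mul_inv (_ + _),
      add_mul]
    simp [m, mul_comm]
  by_cases h2 : v ∈ G.V2
  · refine ⟨.mn (m a) (m b), fun f g hg hfg => ?_⟩
    simp only [ANode.ev, hmon.map_min, ← hfg, m]
    simp [bellman, ht, hS, hR, h2, hsucc]
  · refine ⟨.mx (m a) (m b), fun f g hg hfg => ?_⟩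
    simp only [ANode.ev, hmon.map_max, ← hfg, m]
    simp [bellman, ht, hS, hR, h2, hsucc]

end ArrivalInstance

/-- the value of an instance in simple form is rational with
    numerator and denominator (in lowest terms) at most `4 ^ (|V| * 2 ^ |V_S|)`. -/
theorem stmt_2 {V : Type} [Fintype V] [DecidableEq V] (G : ArrivalInstance V)
    (d : V) (hG : G.SimpleForm d) :
    ∃ p q : ℕ, 0 < q ∧ Nat.Coprime p q ∧
      p ≤ 4 ^ (Fintype.card V * 2 ^ G.VS.card) ∧
      q ≤ 4 ^ (Fintype.card V * 2 ^ G.VS.card) ∧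
      G.val = (p : ℝ≥0∞) / (q : ℝ≥0∞) := by

  classical
  choose N hN using G.exists_node hG
  let h : ℕ → G.RState → ℝ := fun n => (fun g s => (N s).ev g)^[n] (fun _ => 0)
  have hs : ∀ n s, h (n + 1) s = (N s).ev (h n) := fun n s => by
    simp only [h, Function.iterate_succ_apply']
  have hnn : ∀ n s, 0 ≤ h n s := by
    intro n
    induction n with
    | zero => intro s; exact le_rfl
    | succ n ih =>
      intro s
      rw [hs]
      refine le_trans ?_ (ANode.ev_mono _ ih)
      cases N s <;> simp [ANode.ev]
  have heq : ∀ n (s : G.RState),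
      (G.bellman)^[n] (fun _ => 0) s.1 = ENNReal.ofReal (h n s) := by
    intro n
    induction n with
    | zero => intro s; simp [h]
    | succ n ih =>
      intro s
      rw [Function.iterate_succ_apply', hs]
      exact hN s _ _ (hnn n) ih
  let s0 : G.RState := ⟨(G.start, G.q0), fun v _ => rfl⟩
  obtain ⟨p, q, h1, h2, h3, h4, h5⟩ := abstract_main N h (fun _ => rfl) hs s0
  have hle : 4 ^ Fintype.card G.RState ≤ 4 ^ (Fintype.card V * 2 ^ G.VS.card) :=
    Nat.pow_le_pow_right (by norm_num) (G.card_RState hG)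
  refine ⟨p, q, h1, h2, h3.trans hle, h4.trans hle, ?_⟩
  rw [← h5]
  exact iSup_congr fun n => heq n s0
end

section
/- If G is a generalised arrival instance in simple form with vertex set V and switching vertices V_S and val(G) > 0, then val(G) ≥ 4^{−N}, where N = |V| · 2^{|V_S|}. -/
open Finset
open scoped ENNReal

namespace ArrivalInstance

variable {V : Type} [Fintype V] [DecidableEq V]

/-- states whose switching positions are initial outside the switching vertices -/
def goodStates (G : ArrivalInstance V) : Finset G.State :=
  (Finset.univ : Finset V) ×ˢ
    Fintype.piFinset (fun v => if v ∈ G.VS then Finset.univ else {G.q0 v})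

theorem mem_goodStates (G : ArrivalInstance V) (s : G.State) :
    s ∈ G.goodStates ↔ ∀ v, v ∉ G.VS → s.2 v = G.q0 v := by
  unfold goodStates
  simp only [Finset.mem_product, Finset.mem_univ, true_and, Fintype.mem_piFinset]
  refine forall_congr' fun v => ?_
  by_cases h : v ∈ G.VS <;> simp [h]

theorem card_goodStates (G : ArrivalInstance V) (d : V) (hG : G.SimpleForm d) :
    G.goodStates.card = Fintype.card V * 2 ^ G.VS.card := by
  unfold goodStates
  rw [Finset.card_product, Fintype.card_piFinset, Finset.card_univ]
  congr 1
  have : ∀ v ∈ (Finset.univ : Finset V),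
      (if v ∈ G.VS then (Finset.univ : Finset (Fin (max (G.ord v).length 1)))
        else {G.q0 v}).card = if v ∈ G.VS then 2 else 1 := by
    intro v _
    by_cases h : v ∈ G.VS
    · simp [h, (hG.switch_ord v h).2]
    · simp [h]
  rw [Finset.prod_congr rfl this]
  simp [Finset.prod_ite]

theorem bellman_pos (G : ArrivalInstance V) (f g : G.State → ℝ≥0∞)
    (h : ∀ s ∈ G.goodStates, 0 < f s → 0 < g s) (s : G.State) (hs : s ∈ G.goodStates)
    (hf : 0 < G.bellman f s) : 0 < G.bellman g s := by
  have hw : ∀ w, (w, s.2) ∈ G.goodStates := by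
    intro w
    rw [mem_goodStates] at hs ⊢
    exact hs
  unfold bellman at hf ⊢
  split_ifs at hf ⊢ with h1 h2 h3 h4
  · exact one_pos
  · refine h _ ?_ hf
    rw [mem_goodStates] at hs ⊢
    intro v hv
    have : v ≠ s.1 := fun e => hv (e ▸ h2)
    simpa [switchUpd, this] using hs v hv
  · rw [pos_iff_ne_zero, Ne, Finset.sum_eq_zero_iff] at hf ⊢
    intro hg
    apply hf
    intro w hwm
    have := hg w hwm
    rw [mul_eq_zero] at this ⊢
    refine this.imp id fun h0 => ?_
    by_contra hne
    exact (h _ (hw w) (pos_iff_ne_zero.2 hne)).ne' h0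
  · rw [Finset.lt_inf'_iff] at hf ⊢
    exact fun w hm => h _ (hw w) (hf w hm)
  · rw [Finset.lt_sup'_iff] at hf ⊢
    obtain ⟨w, hm, hp⟩ := hf
    exact ⟨w, hm, h _ (hw w) hp⟩

theorem bellman_bound (G : ArrivalInstance V) (d : V) (hG : G.SimpleForm d)
    (f : G.State → ℝ≥0∞) (c : ℝ≥0∞) (hc : c ≤ 1)
    (h : ∀ s, 0 < f s → c ≤ f s) (s : G.State)
    (hf : 0 < G.bellman f s) : 1 / 2 * c ≤ G.bellman f s := by
  have hhalf : (1 / 2 : ℝ≥0∞) ≤ 1 := by simp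
  have hle : 1 / 2 * c ≤ c := mul_le_of_le_one_left' hhalf
  unfold bellman at hf ⊢
  split_ifs at hf ⊢ with h1 h2 h3 h4
  · exact hle.trans hc
  · exact hle.trans (h _ hf)
  · rw [pos_iff_ne_zero] at hf
    obtain ⟨w, hm, hne⟩ := Finset.exists_ne_zero_of_sum_ne_zero hf
    have h0 : 0 < f (w, s.2) := pos_iff_ne_zero.2 (right_ne_zero_of_mul hne)
    calc 1 / 2 * c ≤ G.P s.1 w * f (w, s.2) := by
          rw [hG.rand_uniform s.1 h3 w hm]
          gcongr
          exact h _ h0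
      _ ≤ _ := Finset.single_le_sum (f := fun w => G.P s.1 w * f (w, s.2))
          (fun _ _ => zero_le) hm
  · rw [Finset.lt_inf'_iff] at hf
    rw [Finset.le_inf'_iff]
    exact fun w hm => hle.trans (h _ (hf w hm))
  · rw [Finset.lt_sup'_iff] at hf
    rw [Finset.le_sup'_iff]
    obtain ⟨w, hm, hp⟩ := hf
    exact ⟨w, hm, hle.trans (h _ hp)⟩

/-- value iteration -/
noncomputable def iter (G : ArrivalInstance V) (n : ℕ) : G.State → ℝ≥0∞ :=
  (G.bellman)^[n] (fun _ => 0)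

theorem iter_succ (G : ArrivalInstance V) (n : ℕ) :
    G.iter (n + 1) = G.bellman (G.iter n) := Function.iterate_succ_apply' _ _ _

theorem iter_bound (G : ArrivalInstance V) (d : V) (hG : G.SimpleForm d) (n : ℕ) :
    ∀ s, 0 < G.iter n s → (1 / 2) ^ n ≤ G.iter n s := by
  induction n with
  | zero => intro s hs; simp [iter] at hs
  | succ n ih =>
    intro s hs
    rw [iter_succ] at hs ⊢
    rw [pow_succ']
    exact G.bellman_bound d hG _ _ (pow_le_one' (by simp) n) ih s hs

theorem iter_pos_succ (G : ArrivalInstance V) (n : ℕ) :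
    ∀ s ∈ G.goodStates, 0 < G.iter n s → 0 < G.iter (n + 1) s := by
  induction n with
  | zero => intro s _ hs; simp [iter] at hs
  | succ n ih =>
    intro s hm hs
    rw [iter_succ] at hs ⊢
    exact G.bellman_pos _ _ ih s hm hs

open Classical in
/-- good states positive after n steps -/
noncomputable def posSet (G : ArrivalInstance V) (n : ℕ) : Finset G.State :=
  G.goodStates.filter (fun s => 0 < G.iter n s)

theorem mem_posSet (G : ArrivalInstance V) (n : ℕ) (s : G.State) :
    s ∈ G.posSet n ↔ s ∈ G.goodStates ∧ 0 < G.iter n s := by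
  simp [posSet]

theorem posSet_mono (G : ArrivalInstance V) : Monotone G.posSet := by
  refine monotone_nat_of_le_succ fun n s hs => ?_
  rw [mem_posSet] at hs ⊢
  exact ⟨hs.1, G.iter_pos_succ n s hs.1 hs.2⟩

theorem posSet_stable (G : ArrivalInstance V) (n : ℕ) (h : G.posSet (n + 1) ⊆ G.posSet n)
    (k : ℕ) : G.posSet (n + k) ⊆ G.posSet n := by
  induction k with
  | zero => exact subset_rfl
  | succ k ih =>
    refine subset_trans (fun s hs => ?_) h
    rw [mem_posSet] at hs ⊢
    refine ⟨hs.1, ?_⟩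
    have h2 := hs.2
    rw [← add_assoc, iter_succ] at h2
    rw [iter_succ]
    refine G.bellman_pos _ _ (fun t ht hp => ?_) s hs.1 h2
    exact ((G.mem_posSet n t).1 (ih ((G.mem_posSet _ t).2 ⟨ht, hp⟩))).2

theorem posSet_sub (G : ArrivalInstance V) (m : ℕ) :
    G.posSet m ⊆ G.posSet G.goodStates.card := by
  by_cases hex : ∃ n ≤ G.goodStates.card, G.posSet (n + 1) ⊆ G.posSet n
  · obtain ⟨n, hn, h⟩ := hex
    have h1 : G.posSet m ⊆ G.posSet (n + m) := G.posSet_mono (by omega)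
    exact (h1.trans (G.posSet_stable n h m)).trans (G.posSet_mono hn)
  · exfalso
    push Not at hex
    have key : ∀ n ≤ G.goodStates.card + 1, n ≤ (G.posSet n).card := by
      intro n
      induction n with
      | zero => intro _; exact Nat.zero_le _
      | succ n ih =>
        intro hn
        have h1 := ih (by omega)
        have h2 : G.posSet n ⊂ G.posSet (n + 1) :=
          ⟨G.posSet_mono (Nat.le_succ n), hex n (by omega)⟩
        have := Finset.card_lt_card h2
        omega
    have h1 := key _ le_rfl
    have h2 : (G.posSet (G.goodStates.card + 1)).card ≤ G.goodStates.card :=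
      Finset.card_le_card fun s hs => ((G.mem_posSet _ s).1 hs).1
    omega

end ArrivalInstance

/-- if the value of an instance in simple form is positive then it
    is at least `4 ^ (-(|V| * 2 ^ |V_S|))`. -/
theorem stmt_3 {V : Type} [Fintype V] [DecidableEq V] (G : ArrivalInstance V)
    (d : V) (hG : G.SimpleForm d) (hpos : 0 < G.val) :
    1 / 4 ^ (Fintype.card V * 2 ^ G.VS.card) ≤ G.val := by
  rw [← G.card_goodStates d hG]
  have hs : (G.start, G.q0) ∈ G.goodStates := by
    rw [ArrivalInstance.mem_goodStates]
    intro v _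
    rfl
  unfold ArrivalInstance.val at hpos
  obtain ⟨m, hm⟩ := lt_iSup_iff.1 hpos
  have h1 := G.posSet_sub m ((G.mem_posSet m _).2 ⟨hs, hm⟩)
  have h2 := G.iter_bound d hG _ _ ((G.mem_posSet _ _).1 h1).2
  calc (1 : ℝ≥0∞) / 4 ^ G.goodStates.card ≤ (1 / 2) ^ G.goodStates.card := by
        rw [one_div, one_div, ← ENNReal.inv_pow]
        apply ENNReal.inv_le_inv.2
        gcongr
        norm_num
    _ ≤ _ := h2
    _ ≤ _ := le_iSup (fun n : ℕ => (G.bellman)^[n] (fun _ => 0) (G.start, G.q0)) _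
end

section
/- For every positive integer n there exists an {R,S}-instance G with exactly n + 4 vertices — a start vertex, n switching vertices, one random vertex with two equiprobable out-neighbours, a target vertex and a dead-end vertex — such that val(G) = 2^{−(2^n − 1)}; in particular 0 < val(G) ≤ 2^{1 − 2^n}. -/
open Finset
open scoped ENNReal

namespace ArrivalInstance

lemma sum_dist_harm {V : Type} [Fintype V] [DecidableEq V] (G : ArrivalInstance V)
    (h : G.State → ℝ≥0∞) (hh : ∀ s, ∑ s', G.stepP s s' * h s' = h s) (m : ℕ) :
    ∑ s, G.dist m s * h s = h (G.start, G.q0) := by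
  induction m with
  | zero => simp [dist]
  | succ m ih =>
    rw [← ih]
    simp only [dist, Finset.sum_mul]
    rw [Finset.sum_comm]
    refine Finset.sum_congr rfl fun s _ => ?_
    rw [← hh s, Finset.mul_sum]
    refine Finset.sum_congr rfl fun s' _ => ?_
    rw [mul_assoc]

lemma stepP_sum_S {V : Type} [Fintype V] [DecidableEq V] (G : ArrivalInstance V)
    (h : G.State → ℝ≥0∞) (s : G.State) (hs : s.1 ∈ G.VS) :
    ∑ s', G.stepP s s' * h s' = h (G.switchNext s.1 s.2, G.switchUpd s.1 s.2) := by
  rw [Finset.sum_eq_single (G.switchNext s.1 s.2, G.switchUpd s.1 s.2)]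
  · simp [stepP, hs]
  · intro b _ hb
    have : ¬ (b.1 = G.switchNext s.1 s.2 ∧ b.2 = G.switchUpd s.1 s.2) := fun h' =>
      hb (Prod.ext h'.1 h'.2)
    simp [stepP, hs, this]
  · simp

lemma stepP_sum_R {V : Type} [Fintype V] [DecidableEq V] (G : ArrivalInstance V)
    (h : G.State → ℝ≥0∞) (s : G.State) (hs : s.1 ∉ G.VS) (hr : s.1 ∈ G.VR) :
    ∑ s', G.stepP s s' * h s' = ∑ w, G.P s.1 w * h (w, s.2) := by
  rw [Fintype.sum_prod_type]
  refine Finset.sum_congr rfl fun w _ => ?_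
  simp [stepP, hs, hr]

lemma stepP_sum_D {V : Type} [Fintype V] [DecidableEq V] (G : ArrivalInstance V)
    (h : G.State → ℝ≥0∞) (s : G.State) (hs : s.1 ∉ G.VS) (hr : s.1 ∉ G.VR) (w : V)
    (hw : G.succ s.1 = {w}) :
    ∑ s', G.stepP s s' * h s' = h (w, s.2) := by
  rw [Finset.sum_eq_single (w, s.2)]
  · simp [stepP, hs, hr, hw]
  · intro b _ hb
    have : ¬ (b.1 = w ∧ b.2 = s.2) := fun h' =>
      hb (Prod.ext h'.1 h'.2)
    simp [stepP, hs, hr, hw, this]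
  · simp

end ArrivalInstance

namespace Cnt

def vx (n k : ℕ) (h : k < n + 4) : Fin (n + 4) := ⟨k, h⟩

lemma eq_vx (n k : ℕ) (h : k < n + 4) (v : Fin (n + 4)) : v = vx n k h ↔ v.1 = k := Fin.ext_iff

def sc (n : ℕ) (v : Fin (n + 4)) : Finset (Fin (n + 4)) :=
  if h : v.1 < n then {vx n (n+1) (by omega), vx n (v.1+1) (by omega)}
  else if v.1 = n + 1 then {vx n 0 (by omega), vx n (n+2) (by omega)}
  else if v.1 = n + 3 then {vx n 0 (by omega)}
  else {v}

def od (n : ℕ) (v : Fin (n + 4)) : List (Fin (n + 4)) :=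
  if h : v.1 < n then [vx n (n+1) (by omega), vx n (v.1+1) (by omega)] else []

noncomputable def G (n : ℕ) (_hn : 0 < n) : ArrivalInstance (Fin (n + 4)) where
  succ := sc n
  succ_nonempty v := by unfold sc; split_ifs <;> simp
  start := vx n (n+3) (by omega)
  target := vx n n (by omega)
  VR := {vx n (n+1) (by omega)}
  VS := Finset.univ.filter fun v => v.1 < n
  V1 := ∅
  V2 := ∅
  target_loop := by simp [sc, vx]
  target_not_R := by simp [vx]
  target_not_S := by simp [vx]
  target_not_1 := by simp
  target_not_2 := by simp
  disj_RS := by simp [vx]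
  disj_R1 := by simp
  disj_R2 := by simp
  disj_S1 := by simp
  disj_S2 := by simp
  disj_12 := by simp
  cover v h1 h2 _ _ := by
    have h1' : v.1 ≠ n + 1 := by simpa [vx, Fin.ext_iff] using h1
    have h2' : ¬ v.1 < n := by simpa using h2
    unfold sc
    rw [dif_neg h2', if_neg h1']
    split_ifs <;> simp
  P _ w := if w.1 = 0 ∨ w.1 = n + 2 then 1 / 2 else 0
  P_le_one v w := by split_ifs <;> simp
  P_support v hv w := by
    have h1' : v.1 = n + 1 := by simpa [vx, Fin.ext_iff] using hv
    simp [sc, h1', eq_vx, -Fin.val_eq_zero_iff]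
    tauto
  P_sum v hv := by
    have h1' : v.1 = n + 1 := by simpa [vx, Fin.ext_iff] using hv
    simp [sc, h1', vx, ENNReal.inv_two_add_inv_two]
  ord := od n
  ord_mem v hv w := by
    have h2' : v.1 < n := by simpa using hv
    simp [sc, od, h2']

variable {n : ℕ} {hn : 0 < n}

def bit (q : (G n hn).QType) (k : ℕ) : ℕ := if h : k < n + 4 then (q ⟨k, h⟩ : ℕ) else 0

def ct (q : (G n hn).QType) : ℕ := ∑ k ∈ Finset.range n, bit q k * 2 ^ k

lemma q_lt (q : (G n hn).QType) (v : Fin (n+4)) : (q v : ℕ) < 2 := by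
  refine lt_of_lt_of_le (q v).2 ?_
  change max (od n v).length 1 ≤ 2
  unfold od
  split_ifs <;> simp

lemma bit_le (q : (G n hn).QType) (k : ℕ) : bit q k ≤ 1 := by
  unfold bit
  split_ifs with h
  · have := q_lt q ⟨k, h⟩; omega
  · omega

lemma ct_lt (q : (G n hn).QType) : ct q < 2 ^ n := by
  have : ∀ m, ∑ k ∈ Finset.range m, bit q k * 2 ^ k < 2 ^ m := by
    intro m
    induction m with
    | zero => simp
    | succ m ih =>
      rw [Finset.sum_range_succ, pow_succ]
      have := Nat.mul_le_mul_right (2^m) (bit_le q m)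
      omega
  exact this n

lemma ct_q0 : ct (G n hn).q0 = 0 := by
  unfold ct
  refine Finset.sum_eq_zero fun k _ => ?_
  simp [bit, ArrivalInstance.q0]

lemma len_eq (v : Fin (n+4)) (hv : v.1 < n) : max ((G n hn).ord v).length 1 = 2 := by
  change max (od n v).length 1 = 2
  simp [od, hv]

lemma ct_upd (q : (G n hn).QType) (v : Fin (n+4)) (hv : v.1 < n) :
    ct ((G n hn).switchUpd v q) + (q v : ℕ) * 2 ^ v.1
      = ct q + (1 - (q v : ℕ)) * 2 ^ v.1 := by
  have hmem : v.1 ∈ Finset.range n := by simpa using hv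
  have h1 : bit ((G n hn).switchUpd v q) v.1 = 1 - (q v : ℕ) := by
    have := q_lt q v
    simp only [bit, v.2, dif_pos, ArrivalInstance.switchUpd, Fin.eta, Function.update_self,
      len_eq v hv]
    omega
  have h2 : bit q v.1 = (q v : ℕ) := by simp [bit]
  have h3 : ∀ k ∈ (Finset.range n).erase v.1,
      bit ((G n hn).switchUpd v q) k * 2 ^ k = bit q k * 2 ^ k := by
    intro k hk
    congr 1
    unfold bit
    split_ifs with h
    · have : (⟨k, h⟩ : Fin (n+4)) ≠ v := by
        intro h'; simp [← h'] at hk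
      simp [ArrivalInstance.switchUpd, Function.update_of_ne this]
    · rfl
  unfold ct
  rw [← Finset.add_sum_erase _ _ hmem, ← Finset.add_sum_erase (Finset.range n)
    (fun k => bit q k * 2 ^ k) hmem, Finset.sum_congr rfl h3, h1, h2]
  ring

def ex (s : (G n hn).State) : ℕ :=
  if s.1.1 ≤ n then 2 ^ n - (ct s.2 + 2 ^ s.1.1)
  else if s.1.1 = n + 1 then 2 ^ n - ct s.2
  else 2 ^ n - (ct s.2 + 1)

noncomputable def hm (s : (G n hn).State) : ℝ≥0∞ :=
  if s.1.1 = n + 2 then 0 else (1 / 2) ^ ex s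

def rk (s : (G n hn).State) : ℕ :=
  ex s * (n + 3) + (if s.1.1 < n then n - s.1.1 else if s.1.1 = n + 3 then n + 1 else 0)

lemma next_zero (v : Fin (n+4)) (q : (G n hn).QType) (hv : v.1 < n) (hq : (q v : ℕ) = 0) :
    (G n hn).switchNext v q = vx n (n+1) (by omega) := by
  unfold ArrivalInstance.switchNext
  rw [hq]
  change (od n v).getD 0 v = _
  simp [od, hv]

lemma next_one (v : Fin (n+4)) (q : (G n hn).QType) (hv : v.1 < n) (hq : (q v : ℕ) = 1) :
    (G n hn).switchNext v q = vx n (v.1+1) (by omega) := by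
  unfold ArrivalInstance.switchNext
  rw [hq]
  change (od n v).getD 1 v = _
  simp [od, hv]

/-- a switching step keeps the exponent, decreases the rank and does not enter the dead end -/
lemma step_S (v : Fin (n+4)) (q : (G n hn).QType) (hv : v.1 < n) :
    ex ((G n hn).switchNext v q, (G n hn).switchUpd v q) = ex (v, q) ∧
    rk ((G n hn).switchNext v q, (G n hn).switchUpd v q) < rk (v, q) ∧
    ((G n hn).switchNext v q).1 ≠ n + 2 := by
  have hu := ct_upd q v hv
  have hq2 := q_lt q v
  have hc : (q v : ℕ) = 0 ∨ (q v : ℕ) = 1 := by omega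
  rcases hc with hq | hq
  · rw [hq] at hu
    have he : ex ((G n hn).switchNext v q, (G n hn).switchUpd v q) = ex (v, q) := by
      simp only [next_zero v q hv hq, ex, vx]
      simp [hv.le]; omega
    refine ⟨he, ?_, ?_⟩
    · unfold rk
      rw [he]
      simp [next_zero v q hv hq, vx, hv]
    · simp [next_zero v q hv hq, vx]
  · rw [hq] at hu
    have he : ex ((G n hn).switchNext v q, (G n hn).switchUpd v q) = ex (v, q) := by
      simp only [next_one v q hv hq, ex, vx]
      have : v.1 + 1 ≤ n := hv
      simp only [this, hv.le, if_true, pow_succ]; omega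
    refine ⟨he, ?_, ?_⟩
    · unfold rk
      rw [he]
      simp only [next_one v q hv hq, vx, hv, if_true]
      split_ifs <;> omega
    · simp only [next_one v q hv hq, vx]; omega

lemma P_eq (v w : Fin (n+4)) : (G n hn).P v w = if w.1 = 0 ∨ w.1 = n + 2 then 1 / 2 else 0 := rfl

lemma mem_VS (v : Fin (n+4)) : v ∈ (G n hn).VS ↔ v.1 < n := by simp [G]
lemma mem_VR (v : Fin (n+4)) : v ∈ (G n hn).VR ↔ v.1 = n + 1 := by simp [G, eq_vx]

lemma ex_r (v : Fin (n+4)) (q : (G n hn).QType) (hv : v.1 = n + 1) :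
    ex (v, q) = ex (hn := hn) (vx n 0 (by omega), q) + 1 := by
  have := ct_lt q
  simp [ex, hv, vx]; omega

lemma ex_s (v : Fin (n+4)) (q : (G n hn).QType) (hv : v.1 = n + 3) :
    ex (v, q) = ex (hn := hn) (vx n 0 (by omega), q) := by
  simp [ex, hv, vx]

lemma harm (s : (G n hn).State) : ∑ s', (G n hn).stepP s s' * hm s' = hm s := by
  obtain ⟨v, q⟩ := s
  by_cases hS : v.1 < n
  · rw [ArrivalInstance.stepP_sum_S _ _ _ ((mem_VS v).2 hS)]
    obtain ⟨h1, _, h3⟩ := step_S v q hS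
    have : v.1 ≠ n + 2 := by omega
    simp [hm, h1, h3, this]
  have hS' : v ∉ (G n hn).VS := by rwa [mem_VS]
  by_cases hR : v.1 = n + 1
  · rw [ArrivalInstance.stepP_sum_R _ _ _ hS' ((mem_VR v).2 hR)]
    rw [Finset.sum_eq_single (vx n 0 (by omega))]
    · have e := ex_r v q hR
      have hP : (G n hn).P v (vx n 0 (by omega)) = 1 / 2 := by simp [G, vx]
      simp only [hP]
      simp only [hm]
      rw [e, pow_succ, if_neg (by simp [vx]), if_neg (by omega), mul_comm]
    · intro b _ hb
      have hb' : b.1 ≠ 0 := fun h => hb (Fin.ext h)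
      by_cases hd : b.1 = n + 2
      · simp [hm, hd]
      · simp [P_eq, hb', hd, -Fin.val_eq_zero_iff]
    · simp
  have hR' : v ∉ (G n hn).VR := by rwa [mem_VR]
  by_cases h3 : v.1 = n + 3
  · rw [ArrivalInstance.stepP_sum_D _ _ _ hS' hR' (vx n 0 (by omega))
      (by change sc n v = _; simp [sc, h3])]
    have e := ex_s v q h3
    simp only [hm]
    rw [e, if_neg (by simp [vx]), if_neg (by omega)]
  · rw [ArrivalInstance.stepP_sum_D _ _ _ hS' hR' v
      (by change sc n v = _; simp [sc, h3, hS, hR])]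

def fin (s : (G n hn).State) : Prop := s.1.1 = n ∨ s.1.1 = n + 2

lemma step_rk (s s' : (G n hn).State) (h : (G n hn).stepP s s' ≠ 0) :
    fin s' ∨ (¬ fin s ∧ rk s' < rk s) := by
  obtain ⟨v, q⟩ := s
  obtain ⟨v', q'⟩ := s'
  by_cases hS : v.1 < n
  · have hS' : v ∈ (G n hn).VS := (mem_VS v).2 hS
    simp only [ArrivalInstance.stepP, hS', if_true] at h
    have h' : v' = (G n hn).switchNext v q ∧ q' = (G n hn).switchUpd v q := by
      by_contra hc; simp [hc] at h
    rw [h'.1, h'.2]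
    exact Or.inr ⟨by unfold fin; simp only; omega, (step_S v q hS).2.1⟩
  have hS' : v ∉ (G n hn).VS := by rwa [mem_VS]
  by_cases hR : v.1 = n + 1
  · have hR' : v ∈ (G n hn).VR := (mem_VR v).2 hR
    simp only [ArrivalInstance.stepP, hS', hR', if_true, if_false] at h
    have h1 : q' = q := by by_contra hc; simp [hc] at h
    have h2 : v'.1 = 0 ∨ v'.1 = n + 2 := by
      by_contra hc; exact h (by rw [P_eq, if_neg hc, ite_self])
    rcases h2 with h2 | h2
    · have : v' = vx n 0 (by omega) := Fin.ext h2
      rw [this]; subst h1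
      refine Or.inr ⟨by unfold fin; simp only; omega, ?_⟩
      have e := ex_r v q' hR
      unfold rk
      rw [e]
      simp only [vx, hR, hn, if_true]
      rw [if_neg (by omega), if_neg (by omega), add_mul]
      omega
    · exact Or.inl (Or.inr h2)
  have hR' : v ∉ (G n hn).VR := by rwa [mem_VR]
  simp only [ArrivalInstance.stepP, hS', hR', if_false] at h
  have h' : v' ∈ sc n v ∧ q' = q := by
    by_contra hc
    exact h (if_neg hc)
  by_cases h3 : v.1 = n + 3
  · have h1 : v' = vx n 0 (by omega) := by simpa [sc, h3] using h'.1
    rw [h1, h'.2]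
    refine Or.inr ⟨by unfold fin; simp only; omega, ?_⟩
    have e := ex_s v q h3
    unfold rk
    rw [e]
    simp [vx, h3, hn]
  · have h1 : v' = v := by simpa [sc, h3, hS, hR] using h'.1
    left
    have := v.2
    subst h1
    unfold fin; simp only; omega

lemma dist_rk (m : ℕ) (s : (G n hn).State) (h : (G n hn).dist m s ≠ 0) :
    fin s ∨ rk s + m ≤ rk ((G n hn).start, (G n hn).q0) := by
  induction m generalizing s with
  | zero =>
    right
    have : s = ((G n hn).start, (G n hn).q0) := by
      by_contra hc; simp [ArrivalInstance.dist, hc] at h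
    rw [this]; rfl
  | succ m ih =>
    simp only [ArrivalInstance.dist] at h
    obtain ⟨s', _, hs'⟩ := Finset.exists_ne_zero_of_sum_ne_zero h
    rcases step_rk s' s (right_ne_zero_of_mul hs') with h1 | ⟨h1, h2⟩
    · exact Or.inl h1
    · rcases ih s' (left_ne_zero_of_mul hs') with h3 | h3
      · exact absurd h3 h1
      · right; omega

lemma hm_start : hm ((G n hn).start, (G n hn).q0) = (1 / 2) ^ (2 ^ n - 1) := by
  have h : (G n hn).start.1 = n + 3 := rfl
  simp [hm, ex, ct_q0, h]

lemma hm_target (q : (G n hn).QType) : hm ((G n hn).target, q) = 1 := by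
  simp [hm, ex, G, vx]

lemma chainVal_eq : (G n hn).chainVal = (1 / 2) ^ (2 ^ n - 1) := by
  have key := fun m => (ArrivalInstance.sum_dist_harm (G n hn) hm harm m).trans hm_start
  have inner : ∀ m, ∑ q : (G n hn).QType, (G n hn).dist m ((G n hn).target, q)
      = ∑ q : (G n hn).QType, (G n hn).dist m ((G n hn).target, q) * hm ((G n hn).target, q) := by
    intro m
    simp [hm_target]
  apply le_antisymm
  · refine iSup_le fun m => ?_
    rw [← key m, inner, Fintype.sum_prod_type]
    exact Finset.single_le_sum
      (f := fun v => ∑ q : (G n hn).QType, (G n hn).dist m (v, q) * hm (v, q))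
      (fun _ _ => zero_le) (Finset.mem_univ _)
  · let M := rk ((G n hn).start, (G n hn).q0) + 1
    refine le_trans (le_of_eq ?_) (le_iSup _ M)
    rw [← key M, inner, Fintype.sum_prod_type]
    refine Finset.sum_eq_single _ (fun v _ hv => ?_) (by simp)
    refine Finset.sum_eq_zero fun q _ => ?_
    by_cases hd : (G n hn).dist M (v, q) = 0
    · simp [hd]
    · rcases dist_rk M (v, q) hd with (h | h) | h
      · exact absurd (Fin.ext h) hv
      · have h' : v.1 = n + 2 := h
        simp [hm, h']
      · simp only [M] at h; omega

end Cnt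

/-- an {R,S}-instance with `n + 4` vertices (a start vertex, `n`
    switching vertices, one random vertex with two equiprobable out-neighbours,
    a target and a dead end) whose value is exactly `2 ^ (-(2 ^ n - 1))`. -/
theorem stmt_4 (n : ℕ) (hn : 0 < n) :
    ∃ (G : ArrivalInstance (Fin (n + 4))) (d : Fin (n + 4)),
      G.IsRS ∧
      d ≠ G.target ∧ G.succ d = {d} ∧ d ∉ G.VR ∧ d ∉ G.VS ∧
      G.start ∉ G.VR ∧ G.start ∉ G.VS ∧ G.start ≠ G.target ∧ G.start ≠ d ∧
      G.VS.card = n ∧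
      (∃ r : Fin (n + 4), G.VR = {r} ∧ (G.succ r).card = 2 ∧
        ∀ u ∈ G.succ r, G.P r u = 1 / 2) ∧
      G.chainVal = (1 / 2 : ℝ≥0∞) ^ (2 ^ n - 1) ∧
      0 < G.chainVal ∧ G.chainVal ≤ 2 / 2 ^ (2 ^ n) := by
  have hval := Cnt.chainVal_eq (n := n) (hn := hn)
  have hcard : (Finset.univ.filter fun v : Fin (n + 4) => v.1 < n).card = n := by
    have := Fin.card_filter_val_lt (n := n + 4) (m := n)
    simpa using this
  refine ⟨Cnt.G n hn, Cnt.vx n (n+2) (by omega), ⟨rfl, rfl⟩, ?_, ?_, ?_, ?_, ?_, ?_, ?_, ?_,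
    hcard, ⟨Cnt.vx n (n+1) (by omega), rfl, ?_, ?_⟩, hval, ?_, ?_⟩
  · simp [Cnt.G, Cnt.vx]
  · change Cnt.sc n _ = _
    simp [Cnt.sc, Cnt.vx]
  · simp [Cnt.G, Cnt.vx]
  · simp [Cnt.G, Cnt.vx]
  · simp [Cnt.G, Cnt.vx]
  · simp [Cnt.G, Cnt.vx]
  · simp [Cnt.G, Cnt.vx]
  · simp [Cnt.G, Cnt.vx]
  · change (Cnt.sc n _).card = _
    simp [Cnt.sc, Cnt.vx]
  · intro u hu
    have hu' : u ∈ Cnt.sc n (Cnt.vx n (n+1) (by omega)) := hu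
    have : u.1 = 0 ∨ u.1 = n + 2 := by
      have e : Cnt.sc n (Cnt.vx n (n+1) (by omega))
          = {Cnt.vx n 0 (by omega), Cnt.vx n (n+2) (by omega)} := by simp [Cnt.sc, Cnt.vx]
      rw [e, Finset.mem_insert, Finset.mem_singleton, Cnt.eq_vx, Cnt.eq_vx] at hu'
      exact hu'
    rw [Cnt.P_eq, if_pos this]
  · rw [hval]
    exact ENNReal.pow_pos (by simp) _
  · rw [hval]
    have h1 : 2 ^ n = (2 ^ n - 1) + 1 := by
      have := Nat.one_le_two_pow (n := n); omega
    have h2 : (2 : ℝ≥0∞) ^ (2 ^ n) = 2 ^ (2 ^ n - 1) * 2 := by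
      conv_lhs => rw [h1]
      rw [pow_succ]
    rw [h2, ENNReal.le_div_iff_mul_le (by simp) (by left; finiteness)]
    rw [← mul_assoc, ← mul_pow]
    simp [ENNReal.inv_mul_cancel]
end

section
/- Let G be an {R,S}-instance and let G' be the {S,1}-instance on the same vertex set obtained by declaring every random vertex of G to be a max-player vertex and deleting every edge (v,u) out of a random vertex v with P(v,u) = 0. Then val(G) > 0 if and only if val(G') = 1. -/
open Finset
open scoped ENNReal

theorem ArrivalInstance.sup'_ind {V : Type} (s : Finset V) (hs : s.Nonempty) (f : V → ℝ≥0∞)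
    (A : Prop) [Decidable A] (h01 : ∀ w ∈ s, f w = 0 ∨ f w = 1)
    (hA : A ↔ ∃ w ∈ s, f w = 1) :
    s.sup' hs f = if A then 1 else 0 := by
  split_ifs with h
  · obtain ⟨w, hw, h1⟩ := hA.1 h
    apply le_antisymm
    · apply Finset.sup'_le
      intro b hb
      rcases h01 b hb with h | h <;> simp [h]
    · rw [← h1]
      exact Finset.le_sup' f hw
  · apply le_antisymm _ (zero_le)
    apply Finset.sup'_le
    intro b hb
    rcases h01 b hb with h' | h'
    · simp [h']
    · exact absurd (hA.2 ⟨b, hb, h'⟩) h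

open Classical in
theorem ArrivalInstance.iter_ind {V : Type} [Fintype V] [DecidableEq V]
    (G G' : ArrivalInstance V) (hRS : G.IsRS)
    (hsucc : ∀ v u : V, u ∈ G'.succ v ↔ u ∈ G.succ v ∧ (v ∈ G.VR → G.P v u ≠ 0))
    (htarget : G'.target = G.target)
    (hVR : G'.VR = ∅) (hVS : G'.VS = G.VS)
    (hV2 : G'.V2 = ∅) (hord : G'.ord = G.ord) (n : ℕ) :
    ∀ (v : V) (q : G.QType) (q' : G'.QType), (∀ u, (q u : ℕ) = q' u) →
      (G'.bellman)^[n] (fun _ => 0) (v, q') =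
        if 0 < (G.bellman)^[n] (fun _ => 0) (v, q) then 1 else 0 := by
  induction n with
  | zero => intro v q q' h; simp
  | succ n ih =>
    intro v q q' h
    rw [Function.iterate_succ_apply', Function.iterate_succ_apply']
    generalize (G.bellman)^[n] (fun _ => 0) = f at ih ⊢
    generalize (G'.bellman)^[n] (fun _ => 0) = f' at ih ⊢
    unfold bellman
    simp only [htarget, hVR, hVS, hV2, hRS.2, Finset.notMem_empty, if_false]
    by_cases ht : v = G.target
    · simp [ht]
    by_cases hS : v ∈ G.VS
    · simp only [ht, hS, if_true, if_false]
      have e : G'.switchNext v q' = G.switchNext v q := by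
        simp [switchNext, hord, h]
      rw [e]
      apply ih
      intro u
      unfold switchUpd
      by_cases hu : u = v
      · subst hu; simp [hord, h]
      · simp [Function.update_of_ne hu, h]
    have h01 : ∀ w, f' (w, q') = 0 ∨ f' (w, q') = 1 := by
      intro w; rw [ih w q q' h]; split_ifs <;> simp
    have h1 : ∀ w, f' (w, q') = 1 ↔ 0 < f (w, q) := by
      intro w; rw [ih w q q' h]; split_ifs with h <;> simp [h]
    by_cases hR : v ∈ G.VR
    · simp only [ht, hS, hR, if_true, if_false]
      apply sup'_ind _ _ _ _ (fun w _ => h01 w)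
      simp only [h1, hsucc, pos_iff_ne_zero, ne_eq, Finset.sum_eq_zero_iff, mul_eq_zero]
      push Not
      constructor
      · rintro ⟨w, a, b, c⟩; exact ⟨w, ⟨a, fun _ => b⟩, c⟩
      · rintro ⟨w, ⟨a, b⟩, c⟩; exact ⟨w, a, b hR, c⟩
    · simp only [ht, hS, hR, if_false]
      apply sup'_ind _ _ _ _ (fun w _ => h01 w)
      simp only [h1, hsucc, Finset.lt_sup'_iff]
      simp [hR]

/-- giving the max player control of the random vertices of an
    {R,S}-instance (deleting zero-probability edges) turns "positive value"
    into "value one". -/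
theorem stmt_8 {V : Type} [Fintype V] [DecidableEq V]
    (G G' : ArrivalInstance V) (hRS : G.IsRS)
    (hsucc : ∀ v u : V, u ∈ G'.succ v ↔ u ∈ G.succ v ∧ (v ∈ G.VR → G.P v u ≠ 0))
    (hstart : G'.start = G.start) (htarget : G'.target = G.target)
    (hVR : G'.VR = ∅) (hVS : G'.VS = G.VS) (hV1 : G'.V1 = G.VR)
    (hV2 : G'.V2 = ∅) (hord : G'.ord = G.ord) :
    0 < G.val ↔ G'.val = 1 := by
  classical
  have key : ∀ n, (G'.bellman)^[n] (fun _ => 0) (G'.start, G'.q0) =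
      if 0 < (G.bellman)^[n] (fun _ => 0) (G.start, G.q0) then 1 else 0 := by
    intro n
    rw [hstart]
    rw [ArrivalInstance.iter_ind G G' hRS hsucc htarget hVR hVS hV2 hord n G.start G.q0 G'.q0
      (fun u => rfl)]
  unfold ArrivalInstance.val
  rw [lt_iSup_iff]
  simp only [key]
  constructor
  · rintro ⟨n, hn⟩
    apply le_antisymm
    · apply iSup_le
      intro i
      split_ifs <;> simp
    · apply le_iSup_of_le n
      rw [if_pos hn]
  · intro h
    by_contra hc
    push Not at hc
    have : ∀ n, ¬ 0 < (G.bellman)^[n] (fun _ => 0) (G.start, G.q0) := fun n => not_lt.2 (hc n)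
    simp [this] at h
end

section
/- Let G be an {S,1}-instance and let G' be the {R,S}-instance on the same graph obtained by declaring every max-player vertex of G to be a random vertex with the uniform distribution on its out-neighbours. Then val(G) = 1 if and only if val(G') > 0. -/
open Finset
open scoped ENNReal

theorem sup'_zero_one {V : Type} (t : Finset V) (ht : t.Nonempty) (f : V → ℝ≥0∞)
    (hf : ∀ w, f w = 0 ∨ f w = 1) : t.sup' ht f = 0 ∨ t.sup' ht f = 1 := by
  obtain ⟨w, _, hw⟩ := Finset.exists_mem_eq_sup' ht f
  rw [hw]; exact hf w

theorem sup'_ne_zero {V : Type} (t : Finset V) (ht : t.Nonempty) (f : V → ℝ≥0∞) :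
    t.sup' ht f ≠ 0 ↔ ∃ w ∈ t, f w ≠ 0 := by
  rw [← pos_iff_ne_zero, Finset.lt_sup'_iff]
  simp only [pos_iff_ne_zero]

theorem stmt_9_aux {V : Type} [Fintype V] [DecidableEq V]
    (G G' : ArrivalInstance V) (hR : G.VR = ∅) (h2 : G.V2 = ∅)
    (hsucc : G'.succ = G.succ) (hstart : G'.start = G.start)
    (htarget : G'.target = G.target)
    (hVR : G'.VR = G.V1) (hVS : G'.VS = G.VS)
    (hV2 : G'.V2 = ∅) (hord : G'.ord = G.ord) (n : ℕ) :
    ((G.bellman)^[n] (fun _ => 0) (G.start, G.q0) = 0 ∨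
      (G.bellman)^[n] (fun _ => 0) (G.start, G.q0) = 1) ∧
    ((G.bellman)^[n] (fun _ => 0) (G.start, G.q0) ≠ 0 ↔
      (G'.bellman)^[n] (fun _ => 0) (G'.start, G'.q0) ≠ 0) := by
  have hsupp := G'.P_support
  have hds := G.disj_S1
  obtain ⟨succ', a1, start', target', VR', VS', V1', V2', b1, b2, b3, b4, b5, c1, c2, c3, c4,
    c5, c6, d1, P', e1, e2, e3, ord', e4⟩ := G'
  dsimp only at hsucc hstart htarget hVR hVS hV2 hord hsupp
  subst hsucc hstart htarget hVR hVS hV2 hord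
  suffices H : ∀ (s : G.State),
    ((G.bellman)^[n] (fun _ => 0) s = 0 ∨ (G.bellman)^[n] (fun _ => 0) s = 1) ∧
    ((G.bellman)^[n] (fun _ => 0) s ≠ 0 ↔
      ((ArrivalInstance.mk G.succ a1 G.start G.target G.V1 G.VS V1' ∅ b1 b2 b3 b4 b5 c1 c2 c3 c4
    c5 c6 d1 P' e1 e2 e3 G.ord e4).bellman)^[n] (fun _ => 0) s ≠ 0) from H _
  induction n with
  | zero => intro s; simp
  | succ n ih =>
    intro s
    rw [Function.iterate_succ_apply', Function.iterate_succ_apply']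
    generalize (G.bellman)^[n] (fun _ => 0) = f at ih ⊢
    generalize ((ArrivalInstance.mk G.succ a1 G.start G.target G.V1 G.VS V1' ∅ b1 b2 b3 b4 b5 c1 c2
      c3 c4 c5 c6 d1 P' e1 e2 e3 G.ord e4).bellman)^[n] (fun _ => 0) = f' at ih ⊢
    unfold ArrivalInstance.bellman
    dsimp only
    by_cases ht : s.1 = G.target
    · simp [ht]
    by_cases hs : s.1 ∈ G.VS
    · simp only [ht, hs, if_true, if_false]
      exact ih _
    simp only [ht, hs, hR, h2, Finset.notMem_empty, if_false]
    refine ⟨sup'_zero_one _ _ _ fun w => (ih _).1, ?_⟩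
    rw [sup'_ne_zero]
    by_cases h1 : s.1 ∈ G.V1
    · simp only [h1, if_true]
      rw [Ne, Finset.sum_eq_zero_iff]
      push Not
      refine exists_congr fun w => and_congr_right fun hw => ?_
      rw [(ih _).2, mul_ne_zero_iff]
      exact ⟨fun h => ⟨(hsupp _ h1 _).2 hw, h⟩, fun h => h.2⟩
    · simp only [h1, if_false]
      rw [sup'_ne_zero]
      exact exists_congr fun w => and_congr_right fun hw => (ih _).2

/-- replacing the max-player vertices of an {S,1}-instance by
    uniformly random vertices turns "value one" into "positive value". -/
theorem stmt_9 {V : Type} [Fintype V] [DecidableEq V]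
    (G G' : ArrivalInstance V) (hR : G.VR = ∅) (h2 : G.V2 = ∅)
    (hsucc : G'.succ = G.succ) (hstart : G'.start = G.start)
    (htarget : G'.target = G.target)
    (hVR : G'.VR = G.V1) (hVS : G'.VS = G.VS) (hV1 : G'.V1 = ∅)
    (hV2 : G'.V2 = ∅) (hord : G'.ord = G.ord)
    (hP : ∀ v ∈ G.V1, ∀ u ∈ G.succ v, G'.P v u = ((G.succ v).card : ℝ≥0∞)⁻¹) :
    G.val = 1 ↔ 0 < G'.val := by
  have H := stmt_9_aux G G' hR h2 hsucc hstart htarget hVR hVS hV2 hord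
  unfold ArrivalInstance.val
  rw [lt_iSup_iff]
  simp only [pos_iff_ne_zero]
  constructor
  · intro h
    by_contra hc
    push Not at hc
    have : ∀ n, (G.bellman)^[n] (fun _ => 0) (G.start, G.q0) = 0 := fun n => by
      by_contra h0
      exact (H n).2.1 h0 (hc n)
    simp [this] at h
  · rintro ⟨n, hn⟩
    apply le_antisymm
    · refine iSup_le fun m => ?_
      rcases (H m).1 with h | h <;> simp [h]
    · have h1 := (H n).1.resolve_left ((H n).2.2 hn)
      exact h1.symm.le.trans (le_iSup (fun n => (G.bellman)^[n] (fun _ => 0) (G.start, G.q0)) n)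
end

section
/- Let G be an {R,S,2}-instance and let G' be the {S,1,2}-instance on the same vertex set obtained by declaring every random vertex of G to be a max-player vertex and deleting every edge (v,u) out of a random vertex v with P(v,u) = 0. Then val(G) > 0 if and only if val(G') = 1. -/
open Finset
open scoped ENNReal

theorem inf'_rel {V : Type} (S : Finset V) (hS : S.Nonempty) (f g : V → ℝ≥0∞)
    (h : ∀ w, (f w = 0 ∧ g w = 0) ∨ (0 < f w ∧ g w = 1)) :
    (S.inf' hS f = 0 ∧ S.inf' hS g = 0) ∨ (0 < S.inf' hS f ∧ S.inf' hS g = 1) := by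
  by_cases hz : ∃ w ∈ S, f w = 0 ∧ g w = 0
  · obtain ⟨w, hw, h1, h2⟩ := hz
    left
    constructor
    · exact le_antisymm (h1 ▸ Finset.inf'_le f hw) (zero_le)
    · exact le_antisymm (h2 ▸ Finset.inf'_le g hw) (zero_le)
  · have hp : ∀ w ∈ S, 0 < f w ∧ g w = 1 := fun w hw =>
      (h w).resolve_left fun hh => hz ⟨w, hw, hh⟩
    right
    constructor
    · rw [Finset.lt_inf'_iff]
      exact fun w hw => (hp w hw).1
    · obtain ⟨w, hw⟩ := hS
      apply le_antisymm
      · exact (hp w hw).2 ▸ Finset.inf'_le g hw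
      · exact Finset.le_inf' _ _ fun w hw => (hp w hw).2.ge

theorem sup'_rel {V : Type} (S : Finset V) (hS : S.Nonempty) (g : V → ℝ≥0∞) (a : ℝ≥0∞)
    (hg : ∀ w, g w = 0 ∨ g w = 1) (ha : 0 < a ↔ ∃ w ∈ S, g w = 1) :
    (a = 0 ∧ S.sup' hS g = 0) ∨ (0 < a ∧ S.sup' hS g = 1) := by
  by_cases hz : ∃ w ∈ S, g w = 1
  · right
    refine ⟨ha.2 hz, ?_⟩
    obtain ⟨w, hw, h1⟩ := hz
    apply le_antisymm
    · exact Finset.sup'_le _ _ fun w hw => by rcases hg w with h | h <;> simp [h]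
    · exact h1 ▸ Finset.le_sup' g hw
  · left
    constructor
    · by_contra hne
      exact hz (ha.1 (pos_iff_ne_zero.2 hne))
    · apply le_antisymm _ (zero_le)
      exact Finset.sup'_le _ _ fun w hw =>
        ((hg w).resolve_right fun h => hz ⟨w, hw, h⟩).le

/-- giving the max player control of the random vertices of an
    {R,S,2}-instance (deleting zero-probability edges) turns "positive value"
    into "value one". -/
theorem stmt_10 {V : Type} [Fintype V] [DecidableEq V]
    (G G' : ArrivalInstance V) (h1 : G.V1 = ∅)
    (hsucc : ∀ v u : V, u ∈ G'.succ v ↔ u ∈ G.succ v ∧ (v ∈ G.VR → G.P v u ≠ 0))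
    (hstart : G'.start = G.start) (htarget : G'.target = G.target)
    (hVR : G'.VR = ∅) (hVS : G'.VS = G.VS) (hV1 : G'.V1 = G.VR)
    (hV2 : G'.V2 = G.V2) (hord : G'.ord = G.ord) :
    0 < G.val ↔ G'.val = 1 := by
  have hs : G'.succ = G.succ := by
    funext v
    ext u
    rw [hsucc]
    exact ⟨fun h => h.1, fun h => ⟨h, fun hv => (G.P_support v hv u).2 h⟩⟩
  clear hsucc
  obtain ⟨succ', sne, start', target', VR', VS', V1', V2', a1, a2, a3, a4, a5, b1, b2, b3, b4, b5,
    b6, c1, P', c2, c3, c4, ord', c5⟩ := G'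
  dsimp only at hs hstart htarget hVR hVS hV1 hV2 hord
  subst hs hstart htarget hVR hVS hV1 hV2 hord
  let H : ArrivalInstance V := ⟨G.succ, sne, G.start, G.target, ∅, G.VS, G.VR, G.V2, a1, a2, a3,
    a4, a5, b1, b2, b3, b4, b5, b6, c1, P', c2, c3, c4, G.ord, c5⟩
  have step : ∀ f g : G.State → ℝ≥0∞,
      (∀ s, (f s = 0 ∧ g s = 0) ∨ (0 < f s ∧ g s = 1)) →
      ∀ s : G.State, (G.bellman f s = 0 ∧ H.bellman g s = 0) ∨
        (0 < G.bellman f s ∧ H.bellman g s = 1) := by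
    intro f g h s
    have hg : ∀ s, g s = 0 ∨ g s = 1 := fun s => (h s).imp (fun h => h.2) (fun h => h.2)
    have hfg : ∀ s, 0 < f s ↔ g s = 1 := by
      intro s
      rcases h s with h | h <;> simp [h]
    have hH : H.bellman g s = 
      if s.1 = G.target then 1
      else if s.1 ∈ G.VS then g (G.switchNext s.1 s.2, G.switchUpd s.1 s.2)
      else if s.1 ∈ G.V2 then (G.succ s.1).inf' (G.succ_nonempty s.1) (fun w => g (w, s.2))
      else (G.succ s.1).sup' (G.succ_nonempty s.1) (fun w => g (w, s.2)) := by
      unfold ArrivalInstance.bellman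
      simp only [H, Finset.notMem_empty, if_false]
      rfl
    rw [hH]
    unfold ArrivalInstance.bellman
    by_cases ht : s.1 = G.target
    · simp only [if_pos ht]
      right
      simp
    simp only [if_neg ht]
    by_cases hS : s.1 ∈ G.VS
    · simp only [if_pos hS]
      exact h _
    simp only [if_neg hS]
    by_cases hR : s.1 ∈ G.VR
    · have h2 : s.1 ∉ G.V2 := Finset.disjoint_left.1 G.disj_R2 hR
      simp only [if_pos hR, if_neg h2]
      apply sup'_rel _ _ _ _ (fun w => hg _)
      rw [pos_iff_ne_zero, Ne, Finset.sum_eq_zero_iff]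
      push Not
      refine exists_congr fun w => and_congr_right fun hw => ?_
      have hP := (G.P_support s.1 hR w).2 hw
      rw [← hfg, pos_iff_ne_zero]
      simp [hP]
    simp only [if_neg hR]
    by_cases h2 : s.1 ∈ G.V2
    · simp only [if_pos h2]
      exact inf'_rel _ _ _ _ fun w => h _
    simp only [if_neg h2]
    apply sup'_rel _ _ _ _ (fun w => hg _)
    rw [Finset.lt_sup'_iff]
    simp only [hfg]
  have key : ∀ n : ℕ, ∀ s : G.State,
      ((G.bellman)^[n] (fun _ => 0) s = 0 ∧ (H.bellman)^[n] (fun _ => 0) s = 0) ∨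
      (0 < (G.bellman)^[n] (fun _ => 0) s ∧ (H.bellman)^[n] (fun _ => 0) s = 1) := by
    intro n
    induction n with
    | zero => intro s; left; simp
    | succ n ih =>
      intro s
      rw [Function.iterate_succ_apply', Function.iterate_succ_apply']
      exact step _ _ ih s
  change 0 < G.val ↔ H.val = 1
  have hHv : H.val = ⨆ n : ℕ, (H.bellman)^[n] (fun _ => 0) (G.start, G.q0) := rfl
  rw [hHv]
  unfold ArrivalInstance.val
  rw [lt_iSup_iff]
  constructor
  · rintro ⟨n, hn⟩
    apply le_antisymm
    · apply iSup_le
      intro m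
      rcases key m (G.start, G.q0) with h | h
      · exact h.2.le.trans zero_le_one
      · exact h.2.le
    · rcases key n (G.start, G.q0) with h | h
      · exact absurd h.1 hn.ne'
      · exact h.2.ge.trans (le_iSup (fun n : ℕ => (H.bellman)^[n] (fun _ => 0) (G.start, G.q0)) n)
  · intro h1
    by_contra hne
    have : (⨆ n : ℕ, (H.bellman)^[n] (fun _ => 0) (G.start, G.q0)) ≤ 0 := by
      apply iSup_le
      intro m
      rcases key m (G.start, G.q0) with h | h
      · exact h.2.le
      · exact absurd ⟨m, h.1⟩ hne
    rw [h1] at this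
    exact absurd this (by simp)
end

section
/- Let G be an {S,1,2}-instance and let G' be the {R,S,2}-instance on the same graph obtained by declaring every max-player vertex of G to be a random vertex with the uniform distribution on its out-neighbours. Then val(G) = 1 if and only if val(G') > 0. -/
open Finset
open scoped ENNReal

/-- replacing the max-player vertices of an {S,1,2}-instance by
    uniformly random vertices turns "value one" into "positive value". -/
theorem stmt_11 {V : Type} [Fintype V] [DecidableEq V]
    (G G' : ArrivalInstance V) (hR : G.VR = ∅)
    (hsucc : G'.succ = G.succ) (hstart : G'.start = G.start)
    (htarget : G'.target = G.target)
    (hVR : G'.VR = G.V1) (hVS : G'.VS = G.VS) (hV1 : G'.V1 = ∅)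
    (hV2 : G'.V2 = G.V2) (hord : G'.ord = G.ord)
    (hP : ∀ v ∈ G.V1, ∀ u ∈ G.succ v, G'.P v u = ((G.succ v).card : ℝ≥0∞)⁻¹) :
    G.val = 1 ↔ 0 < G'.val := by
  cases G' with
  | mk succ' sne start' target' VR' VS' V1' V2' tl tR tS t1 t2 d1 d2 d3 d4 d5 d6 cov P' Ple Psupp Psum ord' om =>
  dsimp only at hsucc hstart htarget hVR hVS hV1 hV2 hord hP
  subst hsucc hstart htarget hVR hVS hV1 hV2 hord
  set G' : ArrivalInstance V := ⟨G.succ, sne, G.start, G.target, G.V1, G.VS, ∅, G.V2, tl, tR, tS, t1, t2,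
    d1, d2, d3, d4, d5, d6, cov, P', Ple, Psupp, Psum, G.ord, om⟩ with hG'
  have key : ∀ n (s : G.State),
      ((G.bellman)^[n] (fun _ => 0) s = 0 ∨ (G.bellman)^[n] (fun _ => 0) s = 1) ∧
      ((G.bellman)^[n] (fun _ => 0) s = 0 ↔ (G'.bellman)^[n] (fun _ => 0) s = 0) := by
    intro n
    induction n with
    | zero => intro s; simp
    | succ n ih =>
      intro s
      rw [Function.iterate_succ_apply', Function.iterate_succ_apply']
      generalize (G.bellman)^[n] (fun _ => 0) = f at ih
      generalize hg : (G'.bellman)^[n] (fun _ => 0) = g at ih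
      have hsup : ∀ (A : Finset V) (hA : A.Nonempty) (h : V → ℝ≥0∞),
          A.sup' hA h = 0 ↔ ∀ w ∈ A, h w = 0 := by
        intro A hA h
        rw [← nonpos_iff_eq_zero, Finset.sup'_le_iff]
        simp
      have hinf : ∀ (A : Finset V) (hA : A.Nonempty) (h : V → ℝ≥0∞),
          A.inf' hA h = 0 ↔ ∃ w ∈ A, h w = 0 := by
        intro A hA h
        rw [← nonpos_iff_eq_zero, Finset.inf'_le_iff]
        simp
      have hsup1 : (G.succ s.1).sup' (G.succ_nonempty s.1) (fun w => f (w, s.2)) = 0 ∨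
          (G.succ s.1).sup' (G.succ_nonempty s.1) (fun w => f (w, s.2)) = 1 := by
        obtain ⟨w, _, hw⟩ := Finset.exists_mem_eq_sup' (G.succ_nonempty s.1) (fun w => f (w, s.2))
        rw [hw]; exact (ih _).1
      have hinf1 : (G.succ s.1).inf' (G.succ_nonempty s.1) (fun w => f (w, s.2)) = 0 ∨
          (G.succ s.1).inf' (G.succ_nonempty s.1) (fun w => f (w, s.2)) = 1 := by
        obtain ⟨w, _, hw⟩ := Finset.exists_mem_eq_inf' (G.succ_nonempty s.1) (fun w => f (w, s.2))
        rw [hw]; exact (ih _).1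
      have e1 : G.bellman f s = if s.1 = G.target then 1
          else if s.1 ∈ G.VS then f (G.switchNext s.1 s.2, G.switchUpd s.1 s.2)
          else if s.1 ∈ G.V2 then (G.succ s.1).inf' (G.succ_nonempty s.1) (fun w => f (w, s.2))
          else (G.succ s.1).sup' (G.succ_nonempty s.1) (fun w => f (w, s.2)) := by
        simp [ArrivalInstance.bellman, hR]
      have e2 : G'.bellman g s = if s.1 = G.target then 1
          else if s.1 ∈ G.VS then g (G.switchNext s.1 s.2, G.switchUpd s.1 s.2)
          else if s.1 ∈ G.V1 then ∑ w ∈ G.succ s.1, P' s.1 w * g (w, s.2)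
          else if s.1 ∈ G.V2 then (G.succ s.1).inf' (G.succ_nonempty s.1) (fun w => g (w, s.2))
          else (G.succ s.1).sup' (G.succ_nonempty s.1) (fun w => g (w, s.2)) := rfl
      rw [e1, e2]
      by_cases c1 : s.1 = G.target
      · simp [c1]
      by_cases c2 : s.1 ∈ G.VS
      · simp only [c1, c2, if_true, if_false]; exact ih _
      by_cases c3 : s.1 ∈ G.V1
      · have c4 : s.1 ∉ G.V2 := Finset.disjoint_left.mp G.disj_12 c3
        simp only [c1, c2, c3, c4, if_true, if_false]
        refine ⟨hsup1, ?_⟩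
        rw [hsup, Finset.sum_eq_zero_iff]
        refine forall₂_congr fun w hw => ?_
        rw [mul_eq_zero, (ih _).2]
        have := (Psupp s.1 c3 w).2 hw
        tauto
      by_cases c4 : s.1 ∈ G.V2
      · simp only [c1, c2, c3, c4, if_true, if_false]
        refine ⟨hinf1, ?_⟩
        rw [hinf, hinf]
        exact exists_congr fun w => and_congr_right fun _ => (ih _).2
      · simp only [c1, c2, c3, c4, if_false]
        refine ⟨hsup1, ?_⟩
        rw [hsup, hsup]
        exact forall₂_congr fun w _ => (ih _).2
  have v1 : G.val = ⨆ n : ℕ, (G.bellman)^[n] (fun _ => 0) (G.start, G.q0) := rfl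
  have v2 : G'.val = ⨆ n : ℕ, (G'.bellman)^[n] (fun _ => 0) (G.start, G.q0) := rfl
  rw [v1, v2, lt_iSup_iff]
  constructor
  · intro h
    by_contra hc
    push Not at hc
    have : (⨆ n : ℕ, (G.bellman)^[n] (fun _ => 0) (G.start, G.q0)) = 0 := by
      rw [ENNReal.iSup_eq_zero]
      intro n
      exact (key n _).2.2 (nonpos_iff_eq_zero.1 (hc n))
    rw [this] at h
    exact zero_ne_one h
  · rintro ⟨n, hn⟩
    apply le_antisymm
    · refine iSup_le fun m => ?_
      rcases (key m (G.start, G.q0)).1 with h | h <;> simp [h]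
    · refine le_trans ?_ (le_iSup _ n)
      rcases (key n (G.start, G.q0)).1 with h | h
      · exact absurd ((key n _).2.1 h) hn.ne'
      · exact h.ge
end

section
/- Let G be an {S,2}-instance with target t and a dead-end vertex d (whose only out-edge is the self-loop (d,d)) such that every vertex other than d is hopeful. Then for every strategy of the min player, the play started at (s, q_0) eventually reaches t or d; in particular no play cycles forever among the other vertices. -/
open Finset
open scoped ENNReal

namespace ArrivalInstance
variable {V : Type} [Fintype V] [DecidableEq V]

/-- player 1 wins the two-player reachability game from `v`, controlling all
    vertices outside `V2` (least fixed point / attractor). -/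
inductive Wins (G : ArrivalInstance V) : V → Prop
  | target : Wins G G.target
  | choice (v : V) (hv : v ∉ G.V2) (w : V) (hw : w ∈ G.succ v) (h : Wins G w) :
      Wins G v
  | min (v : V) (hv : v ∈ G.V2) (h : ∀ w ∈ G.succ v, Wins G w) : Wins G v

/-- deterministic step of an {S,2}-instance under min-player strategy `τ`;
    vertices in no class (the target and the dead end) are absorbing. -/
def detStep (G : ArrivalInstance V) (τ : G.State → V) (s : G.State) : G.State :=
  if s.1 ∈ G.VS then (G.switchNext s.1 s.2, G.switchUpd s.1 s.2)
  else if s.1 ∈ G.V2 then (τ s, s.2)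
  else s

/-- the deterministic play of an {S,2}-instance under min-player strategy `τ` -/
def detPlay (G : ArrivalInstance V) (τ : G.State → V) : ℕ → G.State
  | 0 => (G.start, G.q0)
  | n + 1 => G.detStep τ (G.detPlay τ n)

end ArrivalInstance


open Filter in
theorem aux_first {V : Type} [Fintype V] [DecidableEq V] (G : ArrivalInstance V)
    (τ : G.State → V) (v : V) (hf : ∃ᶠ n in atTop, (G.detPlay τ n).1 = v) (n : ℕ) :
    ∃ m, n ≤ m ∧ (G.detPlay τ m).1 = v ∧ (G.detPlay τ m).2 v = (G.detPlay τ n).2 v := by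
  have key : ∀ k n, (G.detPlay τ (n + k)).1 = v →
      ∃ m, n ≤ m ∧ (G.detPlay τ m).1 = v ∧ (G.detPlay τ m).2 v = (G.detPlay τ n).2 v := by
    intro k
    induction k with
    | zero => intro n h; exact ⟨n, le_rfl, h, rfl⟩
    | succ k ih =>
      intro n h
      by_cases hv : (G.detPlay τ n).1 = v
      · exact ⟨n, le_rfl, hv, rfl⟩
      · obtain ⟨m, hm, h1, h2⟩ := ih (n + 1) (by rwa [show n + 1 + k = n + (k + 1) by omega])
        refine ⟨m, by omega, h1, h2.trans ?_⟩
        rw [ArrivalInstance.detPlay, ArrivalInstance.detStep]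
        split_ifs
        · simp only [ArrivalInstance.switchUpd]
          rw [Function.update_of_ne (Ne.symm hv)]
        · rfl
        · rfl
  obtain ⟨m, hm, h⟩ := (frequently_atTop.1 hf) n
  exact key (m - n) n (by rw [← h]; congr 3; omega)

open Filter in
theorem aux_switch {V : Type} [Fintype V] [DecidableEq V] (G : ArrivalInstance V)
    (τ : G.State → V) (v : V) (hv : v ∈ G.VS)
    (hf : ∃ᶠ n in atTop, (G.detPlay τ n).1 = v) (n k : ℕ) :
    ∃ m, n ≤ m ∧ (G.detPlay τ m).1 = v ∧
      ((G.detPlay τ m).2 v : ℕ) =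
        (((G.detPlay τ n).2 v : ℕ) + k) % max (G.ord v).length 1 := by
  induction k with
  | zero =>
    obtain ⟨m, hm, h1, h2⟩ := aux_first G τ v hf n
    refine ⟨m, hm, h1, ?_⟩
    rw [h2, add_zero, Nat.mod_eq_of_lt (Fin.is_lt _)]
  | succ k ih =>
    obtain ⟨m, hm, h1, h2⟩ := ih
    obtain ⟨m', hm', h1', h2'⟩ := aux_first G τ v hf (m + 1)
    refine ⟨m', by omega, h1', ?_⟩
    rw [h2', ArrivalInstance.detPlay, ArrivalInstance.detStep, h1, if_pos hv]
    simp only [ArrivalInstance.switchUpd, Function.update_self]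
    rw [h2, Nat.mod_add_mod, add_assoc]

open Filter in
theorem aux_visit {V : Type} [Fintype V] [DecidableEq V] (G : ArrivalInstance V)
    (τ : G.State → V) (v : V) (hv : v ∈ G.VS)
    (hf : ∃ᶠ n in atTop, (G.detPlay τ n).1 = v) (w : V) (hw : w ∈ G.succ v) :
    ∃ᶠ n in atTop, (G.detPlay τ n).1 = w := by
  rw [frequently_atTop]
  intro n
  obtain ⟨i, hi, hiw⟩ := List.mem_iff_getElem.1 ((G.ord_mem v hv w).2 hw)
  have hq := ((G.detPlay τ n).2 v).is_lt
  obtain ⟨m, hm, h1, h2⟩ := aux_switch G τ v hv hf n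
    (max (G.ord v).length 1 - ((G.detPlay τ n).2 v : ℕ) + i)
  have h3 : ((G.detPlay τ m).2 v : ℕ) = i := by
    rw [h2, ← add_assoc, Nat.add_sub_cancel' hq.le, Nat.add_mod_left]
    exact Nat.mod_eq_of_lt (lt_of_lt_of_le hi (le_max_left _ _))
  refine ⟨m + 1, by omega, ?_⟩
  rw [ArrivalInstance.detPlay, ArrivalInstance.detStep, h1, if_pos hv]
  simp only [ArrivalInstance.switchNext]
  rw [h3, List.getD_eq_getElem _ _ hi, hiw]

/-- in an {S,2}-instance with a dead end `d` in which every other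
    vertex is hopeful, every min-player strategy yields a play reaching the
    target or the dead end. -/
theorem stmt_19 {V : Type} [Fintype V] [DecidableEq V] (G : ArrivalInstance V)
    (hR : G.VR = ∅) (h1 : G.V1 = ∅)
    (d : V) (hd : d ≠ G.target) (hdl : G.succ d = {d})
    (hcov : ∀ v : V, v ≠ G.target → v = d ∨ v ∈ G.VS ∪ G.V2)
    (hhope : ∀ v : V, v ≠ d → ArrivalInstance.Wins G v)
    (τ : G.State → V) (hτ : ∀ s : G.State, s.1 ∈ G.V2 → τ s ∈ G.succ s.1) :
    ∃ n : ℕ, (G.detPlay τ n).1 = G.target ∨ (G.detPlay τ n).1 = d := by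
  by_contra hcon
  push Not at hcon
  have key : ∀ v, ArrivalInstance.Wins G v →
      ∀ᶠ n in Filter.atTop, (G.detPlay τ n).1 ≠ v := by
    intro v hw
    induction hw with
    | target => exact Filter.Eventually.of_forall fun n => (hcon n).1
    | choice v hv w hw _ ih =>
      by_contra hf
      rw [← Filter.Frequently.eq_1] at hf
      obtain ⟨n, hn⟩ := hf.exists
      have hS : v ∈ G.VS := by
        rcases hcov v (hn ▸ (hcon n).1) with h | h
        · exact absurd (hn.trans h) (hcon n).2
        · exact (Finset.mem_union.1 h).resolve_right hv
      exact (aux_visit G τ v hS hf w hw) ih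
    | min v hv _ ih =>
      have h := (Filter.eventually_all_finset (G.succ v)).2 ih
      have h' := (Filter.tendsto_add_atTop_nat 1).eventually h
      filter_upwards [h'] with n hn hnv
      have hnS : v ∉ G.VS := fun hS => (Finset.disjoint_left.1 G.disj_S2 hS) hv
      have hτn := hτ (G.detPlay τ n) (hnv.symm ▸ hv)
      rw [hnv] at hτn
      refine hn _ hτn ?_
      rw [ArrivalInstance.detPlay, ArrivalInstance.detStep, hnv, if_neg hnS, if_pos hv]
  have hall : ∀ v : V, ∀ᶠ n in Filter.atTop, (G.detPlay τ n).1 ≠ v := by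
    intro v
    by_cases h : v = d
    · subst h
      exact Filter.Eventually.of_forall fun n => (hcon n).2
    · exact key v (hhope v h)
  obtain ⟨n, hn⟩ := (Filter.eventually_all.2 hall).exists
  exact hn _ rfl
end
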